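/- arXiv:1907.10050 — 2 statements merged into one kernel-verified Lean document; each statement's English description precedes it below -/
import Mathlib

section
/- Let ψ(x) = exp(−‖x‖²), let α ∈ (1,2), let ν_α(du) = c_{α,d}‖u‖^{−d−α}du and let μ_α be the rotationally invariant α-stable probability measure with characteristic function exp(−‖ξ‖^α/2). Let β ∈ (1,α) and let μ be a centered probability measure on ℝ^d with ∫ ‖x‖^β μ(dx) < ∞ and μ ∗ ν_α absolutely continuous with respect to μ. Define E_μ(f,g) = ∫∫ (f(x+u) − f(x))(g(x+u) − g(x)) ν_α(du) μ(dx). Assume: (a) there exists U_μ > 0 such that ∫ f² dμ ≤ U_μ E_μ(f,f) for every bounded Lipschitz f : ℝ^d → ℝ with ∫ f dμ = 0; (b) for g̃_{R,j}(x) = x_j ψ(x/R) − ∫ y_j ψ(y/R) μ(dy), one has lim_{R→∞} ( U_μ E_μ(g̃_{R,j}, g̃_{R,j}) − ∫ g̃_{R,j}² dμ ) = 0 for every j ∈ {1,…,d}. Then there exists a constant C_{α,d} > 0 depending only on α and d such that d_{W₁}(μ, μ_α) ≤ C_{α,d} ( ∫_{‖u‖≤1} ‖u‖² ν_α(du) +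 ∫_{‖u‖≥1} ‖u‖ ν_α(du) ) |U_μ − 1|. -/
open MeasureTheory ProbabilityTheory Filter Set
open scoped RealInnerProductSpace ENNReal NNReal Topology

noncomputable section

/-- The normalizing constant `c_{α,d}` of the rotationally invariant `α`-stable law. -/
def stableCst (d : ℕ) (α : ℝ) : ℝ :=
  -α * (α - 1) * Real.Gamma ((α + d) / 2) /
    (4 * Real.cos (α * Real.pi / 2) * Real.Gamma ((α + 1) / 2) *
      Real.pi ^ (((d : ℝ) - 1) / 2) * Real.Gamma (2 - α))

/-- The Lévy measure `ν_α(du) = c_{α,d} ‖u‖^{−d−α} du`. -/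
def stableLevy (d : ℕ) (α : ℝ) : Measure (EuclideanSpace ℝ (Fin d)) :=
  volume.withDensity fun u => ENNReal.ofReal (stableCst d α / ‖u‖ ^ ((d : ℝ) + α))

/-- The characteristic function of a measure on `ℝ^d`. -/
def charFn {d : ℕ} (μ : Measure (EuclideanSpace ℝ (Fin d)))
    (ξ : EuclideanSpace ℝ (Fin d)) : ℂ :=
  ∫ x, Complex.exp (Complex.I * (⟪ξ, x⟫ : ℂ)) ∂μ

/-- The smooth Wasserstein distance of order `1`. -/
def dW1 {d : ℕ} (μ ν : Measure (EuclideanSpace ℝ (Fin d))) : ℝ :=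
  sSup {r : ℝ | ∃ h : EuclideanSpace ℝ (Fin d) → ℝ, ContDiff ℝ 1 h ∧
    (∀ x, |h x| ≤ 1) ∧ (∀ x, ‖fderiv ℝ h x‖ ≤ 1) ∧
    r = |(∫ x, h x ∂μ) - ∫ x, h x ∂ν|}

/-- The non-local Dirichlet form `E_μ(f,g)` associated with `ν_α` and `μ`. -/
def Eform {d : ℕ} (να μ : Measure (EuclideanSpace ℝ (Fin d)))
    (f g : EuclideanSpace ℝ (Fin d) → ℝ) : ℝ :=
  ∫ x, ∫ u, (f (x + u) - f x) * (g (x + u) - g x) ∂να ∂μ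

/-- The recentered truncated coordinate `g̃_{R,j}` relative to `μ`. -/
def gTruncC {d : ℕ} (μ : Measure (EuclideanSpace ℝ (Fin d))) (R : ℝ) (j : Fin d)
    (x : EuclideanSpace ℝ (Fin d)) : ℝ :=
  x j * Real.exp (-‖R⁻¹ • x‖ ^ 2) - ∫ y, y j * Real.exp (-‖R⁻¹ • y‖ ^ 2) ∂μ

lemma stableCst_pos {d : ℕ} {α : ℝ} (hα : α ∈ Ioo (1 : ℝ) 2) : 0 < stableCst d α := by
  obtain ⟨h1, h2⟩ := hα
  have hcos : Real.cos (α * Real.pi / 2) < 0 :=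
    Real.cos_neg_of_pi_div_two_lt_of_lt (by nlinarith [Real.pi_pos]) (by nlinarith [Real.pi_pos])
  have hd : (0 : ℝ) ≤ d := Nat.cast_nonneg d
  have g1 : 0 < Real.Gamma ((α + d) / 2) := Real.Gamma_pos_of_pos (by linarith)
  have g2 : 0 < Real.Gamma ((α + 1) / 2) := Real.Gamma_pos_of_pos (by linarith)
  have g3 : 0 < Real.Gamma (2 - α) := Real.Gamma_pos_of_pos (by linarith)
  have hpi : 0 < Real.pi ^ (((d : ℝ) - 1) / 2) := Real.rpow_pos_of_pos Real.pi_pos _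
  have hnum : 0 < α * (α - 1) * Real.Gamma ((α + d) / 2) :=
    mul_pos (mul_pos (by linarith) (by linarith)) g1
  have hden : 0 < 4 * (-Real.cos (α * Real.pi / 2)) * Real.Gamma ((α + 1) / 2) *
      Real.pi ^ (((d : ℝ) - 1) / 2) * Real.Gamma (2 - α) := by
    have : 0 < -Real.cos (α * Real.pi / 2) := by linarith
    positivity
  have := div_pos hnum hden
  rw [stableCst]
  convert! this using 1
  rw [← neg_div_neg_eq]
  congr 1 <;> ring

lemma stableCst_mul_eq {d : ℕ} {α : ℝ} (hα : α ∈ Ioo (1 : ℝ) 2) :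
    stableCst d α / Real.Gamma ((d + α) / 2) * (Real.pi ^ ((d : ℝ) / 2) *
      (Real.Gamma (1 - α / 2) * ((1 / 4) ^ (α / 2) / (α / 2)))) = 1 / 2 := by
  obtain ⟨h1, h2⟩ := hα
  have hcos : Real.cos (α * Real.pi / 2) ≠ 0 :=
    (Real.cos_neg_of_pi_div_two_lt_of_lt (by nlinarith [Real.pi_pos])
      (by nlinarith [Real.pi_pos])).ne
  have hd : (0 : ℝ) ≤ d := Nat.cast_nonneg d
  have g1 : Real.Gamma ((d + α) / 2) ≠ 0 := (Real.Gamma_pos_of_pos (by linarith)).ne'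
  have g2 : Real.Gamma ((α + 1) / 2) ≠ 0 := (Real.Gamma_pos_of_pos (by linarith)).ne'
  have g3 : Real.Gamma (2 - α) ≠ 0 := (Real.Gamma_pos_of_pos (by linarith)).ne'
  have g4 : Real.Gamma ((3 - α) / 2) ≠ 0 := (Real.Gamma_pos_of_pos (by linarith)).ne'
  have g5 : Real.Gamma (1 - α / 2) ≠ 0 := (Real.Gamma_pos_of_pos (by linarith)).ne'
  have hdup := Real.Gamma_mul_Gamma_add_half (1 - α / 2)
  rw [show 1 - α / 2 + 1 / 2 = (3 - α) / 2 by ring, show 2 * (1 - α / 2) = 2 - α by ring,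
    show 1 - (2 - α) = α - 1 by ring] at hdup
  have hrefl := Real.Gamma_mul_Gamma_one_sub ((α + 1) / 2)
  have hsin : Real.sin (Real.pi * ((α + 1) / 2)) = Real.cos (α * Real.pi / 2) := by
    rw [← Real.sin_add_pi_div_two]; congr 1; ring
  rw [hsin, show 1 - (α + 1) / 2 = (1 - α) / 2 by ring] at hrefl
  have hrec := Real.Gamma_add_one (s := (1 - α) / 2) (by linarith)
  rw [show (1 - α) / 2 + 1 = (3 - α) / 2 by ring] at hrec
  have hpi : Real.pi ^ ((d : ℝ) / 2) = Real.pi ^ (((d : ℝ) - 1) / 2) * √Real.pi := by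
    rw [Real.sqrt_eq_rpow, ← Real.rpow_add Real.pi_pos]; congr 1; ring
  have hpi0 : Real.pi ^ (((d : ℝ) - 1) / 2) ≠ 0 := (Real.rpow_pos_of_pos Real.pi_pos _).ne'
  have h4 : ((1 : ℝ) / 4) ^ (α / 2) * (2 : ℝ) ^ (α - 1) = 1 / 2 := by
    rw [show (1 : ℝ) / 4 = (2 : ℝ) ^ (-2 : ℝ) by norm_num [Real.rpow_neg], ← Real.rpow_mul (by norm_num),
      ← Real.rpow_add (by norm_num), show -2 * (α / 2) + (α - 1) = -1 by ring, Real.rpow_neg_one]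
    norm_num
  have hsq : √Real.pi * √Real.pi = Real.pi := Real.mul_self_sqrt Real.pi_pos.le
  have key : Real.Gamma ((α + 1) / 2) * Real.Gamma ((3 - α) / 2) * Real.cos (α * Real.pi / 2)
      = (1 - α) / 2 * Real.pi := by
    rw [hrec]
    calc _ = (1 - α) / 2 * (Real.Gamma ((α + 1) / 2) * Real.Gamma ((1 - α) / 2)) *
        Real.cos (α * Real.pi / 2) := by ring
      _ = _ := by rw [hrefl]; field_simp
  have key2 : Real.Gamma (1 - α / 2) * ((1 / 4) ^ (α / 2)) * √Real.pi
      = Real.Gamma (2 - α) * Real.pi / 2 / Real.Gamma ((3 - α) / 2) := by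
    rw [eq_div_iff g4]
    calc _ = (Real.Gamma (1 - α / 2) * Real.Gamma ((3 - α) / 2)) * (1 / 4) ^ (α / 2) * √Real.pi := by
          ring
      _ = Real.Gamma (2 - α) * ((1 / 4) ^ (α / 2) * 2 ^ (α - 1)) * (√Real.pi * √Real.pi) := by
          rw [hdup]; ring
      _ = _ := by rw [h4, hsq]; ring
  have hA : stableCst d α / Real.Gamma ((d + α) / 2) * (Real.pi ^ ((d : ℝ) / 2) *
      (Real.Gamma (1 - α / 2) * ((1 / 4) ^ (α / 2) / (α / 2)))) =
      -(α - 1) / (2 * Real.cos (α * Real.pi / 2) * Real.Gamma ((α + 1) / 2) * Real.Gamma (2 - α)) *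
        (Real.Gamma (1 - α / 2) * ((1 / 4) ^ (α / 2)) * √Real.pi) := by
    rw [stableCst, hpi, add_comm (α : ℝ) d]
    have : α ≠ 0 := by linarith
    field_simp
    ring
  rw [hA, key2]
  have hk : Real.Gamma ((α + 1) / 2) * Real.Gamma ((3 - α) / 2) * Real.cos (α * Real.pi / 2) ≠ 0 := by
    positivity
  calc _ = -(α - 1) * Real.pi / 4 /
      (Real.Gamma ((α + 1) / 2) * Real.Gamma ((3 - α) / 2) * Real.cos (α * Real.pi / 2)) := by
        field_simp; ring
    _ = 1 / 2 := by
        rw [div_eq_iff hk, key]; ring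

lemma lintegral_rpow_mul_exp_neg {a r : ℝ} (ha : 0 < a) (hr : 0 < r) :
    ∫⁻ t in Ioi (0 : ℝ), ENNReal.ofReal (t ^ (a - 1) * Real.exp (-(r * t))) =
      ENNReal.ofReal ((1 / r) ^ a * Real.Gamma a) := by
  have h := Real.integral_rpow_mul_exp_neg_mul_Ioi ha hr
  have hpos : 0 < (1 / r) ^ a * Real.Gamma a := by
    have := Real.Gamma_pos_of_pos ha; positivity
  rw [← h, ofReal_integral_eq_lintegral_ofReal (not_imp_comm.1 integral_undef (by rw [h]; exact hpos.ne'))]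
  filter_upwards [ae_restrict_mem measurableSet_Ioi] with t ht
  have : 0 < t := ht
  positivity

lemma lintegral_rpow_mul_exp_neg_div {a s : ℝ} (ha : a < 1) (hs : 0 < s) :
    ∫⁻ t in Ioi (0 : ℝ), ENNReal.ofReal (t ^ (a - 2) * Real.exp (-(s / t))) =
      ENNReal.ofReal (s ^ (a - 1) * Real.Gamma (1 - a)) := by
  have h := Real.integral_rpow_mul_exp_neg_mul_Ioi (a := 1 - a) (by linarith) hs
  rw [← integral_comp_rpow_Ioi _ (p := -1) (by norm_num)] at h
  have h' : ∫ t in Ioi (0 : ℝ), t ^ (a - 2) * Real.exp (-(s / t)) =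
      s ^ (a - 1) * Real.Gamma (1 - a) := by
    rw [one_div, Real.inv_rpow hs.le, ← Real.rpow_neg hs.le, neg_sub] at h
    rw [← h]
    refine setIntegral_congr_fun measurableSet_Ioi fun t ht => ?_
    have ht : 0 < t := ht
    simp only [smul_eq_mul]
    rw [← Real.rpow_mul ht.le, abs_neg, abs_one, one_mul, ← mul_assoc, ← Real.rpow_add ht,
      Real.rpow_neg_one, div_eq_mul_inv]
    congr 2; ring
  have hpos : 0 < s ^ (a - 1) * Real.Gamma (1 - a) := by
    have := Real.Gamma_pos_of_pos (s := 1 - a) (by linarith); positivity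
  rw [← h', ofReal_integral_eq_lintegral_ofReal (not_imp_comm.1 integral_undef (by rw [h']; exact hpos.ne'))]
  filter_upwards [ae_restrict_mem measurableSet_Ioi] with t ht
  have : 0 < t := ht
  positivity

lemma lintegral_rpow_mul_one_sub_exp {a k : ℝ} (ha0 : 0 < a) (ha : a < 1) (hk : 0 ≤ k) :
    ∫⁻ t in Ioi (0 : ℝ), ENNReal.ofReal (t ^ (a - 1) * (1 - Real.exp (-(k / t)))) =
      ENNReal.ofReal (Real.Gamma (1 - a) * (k ^ a / a)) := by
  have h1 : ∀ t ∈ Ioi (0 : ℝ), ENNReal.ofReal (t ^ (a - 1) * (1 - Real.exp (-(k / t)))) =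
      ∫⁻ s in Ioc 0 k, ENNReal.ofReal (t ^ (a - 2) * Real.exp (-(s / t))) := by
    intro t ht
    have ht : 0 < t := ht
    rw [← ofReal_integral_eq_lintegral_ofReal]
    · congr 1
      rw [← intervalIntegral.integral_of_le hk]
      have hder : ∀ s ∈ uIcc 0 k, HasDerivAt (fun s => -(t ^ (a - 1) * Real.exp (-(s / t))))
          (t ^ (a - 2) * Real.exp (-(s / t))) s := by
        intro s _
        have := ((((hasDerivAt_id s).div_const t).neg.exp).const_mul (t ^ (a - 1))).neg
        convert! this using 1
        rw [show a - 2 = a - 1 - 1 by ring, Real.rpow_sub_one ht.ne']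
        simp only [id]
        field_simp
        rfl
      rw [intervalIntegral.integral_eq_sub_of_hasDerivAt hder
        (Continuous.intervalIntegrable (by fun_prop) _ _)]
      simp
      ring
    · exact (Continuous.integrableOn_Icc (by fun_prop)).mono_set Ioc_subset_Icc_self
    · exact Eventually.of_forall fun s => by positivity
  rw [setLIntegral_congr_fun measurableSet_Ioi h1, lintegral_lintegral_swap (by fun_prop),
    setLIntegral_congr_fun measurableSet_Ioc
      (fun s hs => lintegral_rpow_mul_exp_neg_div ha hs.1), ← ofReal_integral_eq_lintegral_ofReal]
  · congr 1
    rw [integral_mul_const, ← intervalIntegral.integral_of_le hk, integral_rpow (Or.inl (by linarith))]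
    simp [Real.zero_rpow ha0.ne', mul_comm]
  · refine Integrable.mul_const ?_ _
    have := intervalIntegral.intervalIntegrable_rpow' (a := 0) (b := k) (r := a - 1) (by linarith)
    exact (intervalIntegrable_iff_integrableOn_Ioc_of_le hk).1 this
  · filter_upwards [ae_restrict_mem measurableSet_Ioc] with s hs
    have := Real.Gamma_pos_of_pos (s := 1 - a) (by linarith)
    have := hs.1
    positivity

lemma lintegral_exp_neg_mul_one_sub_cos {d : ℕ} {t : ℝ} (ht : 0 < t)
    (ξ : EuclideanSpace ℝ (Fin d)) :
    ∫⁻ u, ENNReal.ofReal (Real.exp (-(‖u‖ ^ 2 * t)) * (1 - Real.cos ⟪ξ, u⟫)) =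
      ENNReal.ofReal ((Real.pi / t) ^ ((d : ℝ) / 2) * (1 - Real.exp (-(‖ξ‖ ^ 2 / 4 / t)))) := by
  have hb : 0 < (t : ℂ).re := by simpa
  have I0 := GaussianFourier.integrable_cexp_neg_mul_sq_norm_add hb 0
    (0 : EuclideanSpace ℝ (Fin d))
  have I1 := GaussianFourier.integrable_cexp_neg_mul_sq_norm_add hb Complex.I ξ
  have V0 := GaussianFourier.integral_cexp_neg_mul_sq_norm_add hb 0
    (0 : EuclideanSpace ℝ (Fin d))
  have V1 := GaussianFourier.integral_cexp_neg_mul_sq_norm_add hb Complex.I ξ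
  have hre : ∀ u : EuclideanSpace ℝ (Fin d),
      Real.exp (-(‖u‖ ^ 2 * t)) * (1 - Real.cos ⟪ξ, u⟫) =
      RCLike.re (Complex.exp (-t * ‖u‖ ^ 2 + 0 * (⟪(0 : EuclideanSpace ℝ (Fin d)), u⟫ : ℝ)) -
        Complex.exp (-t * ‖u‖ ^ 2 + Complex.I * (⟪ξ, u⟫ : ℝ))) := by
    intro u
    have e1 : (-t * ‖u‖ ^ 2 + 0 * (⟪(0 : EuclideanSpace ℝ (Fin d)), u⟫ : ℝ) : ℂ) =
      ((-(‖u‖ ^ 2 * t) : ℝ) : ℂ) := by push_cast; ring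
    rw [e1, ← Complex.ofReal_exp]
    simp only [map_sub, RCLike.re_to_complex, Complex.ofReal_re, Complex.exp_re]
    have e2 : (-t * ‖u‖ ^ 2 + Complex.I * (⟪ξ, u⟫ : ℝ) : ℂ) =
      ((-(‖u‖ ^ 2 * t) : ℝ) : ℂ) + (⟪ξ, u⟫ : ℝ) * Complex.I := by push_cast; ring
    rw [e2]
    simp only [Complex.add_re, Complex.add_im, Complex.ofReal_re, Complex.ofReal_im, Complex.mul_re,
      Complex.mul_im, Complex.I_re, Complex.I_im]
    ring_nf
  have hint := (I0.sub I1).re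
  have hval : ∫ u : EuclideanSpace ℝ (Fin d),
      Real.exp (-(‖u‖ ^ 2 * t)) * (1 - Real.cos ⟪ξ, u⟫) =
      (Real.pi / t) ^ ((d : ℝ) / 2) * (1 - Real.exp (-(‖ξ‖ ^ 2 / 4 / t))) := by
    have e := integral_re (I0.sub I1)
    simp only [Pi.sub_apply] at e
    simp_rw [hre]
    rw [e, integral_sub I0 I1, V0, V1, finrank_euclideanSpace_fin]
    have e1 : ((Real.pi : ℂ) / t) ^ ((d : ℂ) / 2) = (((Real.pi / t) ^ ((d : ℝ) / 2) : ℝ) : ℂ) := by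
      rw [Complex.ofReal_cpow (by positivity)]; push_cast; rfl
    have e2 : Complex.exp (Complex.I ^ 2 * ‖ξ‖ ^ 2 / (4 * t)) =
        ((Real.exp (-(‖ξ‖ ^ 2 / 4 / t)) : ℝ) : ℂ) := by
      push_cast; congr 1; rw [Complex.I_sq]; field_simp
    rw [e1, e2]
    simp only [map_sub, RCLike.re_to_complex, Complex.re_ofReal_mul, Complex.ofReal_re]
    simp
    ring
  rw [← hval, ofReal_integral_eq_lintegral_ofReal]
  · refine hint.congr (Eventually.of_forall fun u => ?_)
    simpa using (hre u).symm
  · refine Eventually.of_forall fun u => ?_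
    exact mul_nonneg (Real.exp_pos _).le (sub_nonneg.2 (Real.cos_le_one _))

lemma measurable_stableLevy_density (d : ℕ) (α : ℝ) : Measurable
    fun u : EuclideanSpace ℝ (Fin d) => stableCst d α / ‖u‖ ^ ((d : ℝ) + α) := by fun_prop

lemma lintegral_one_sub_cos_stableLevy {d : ℕ} {α : ℝ} (hα : α ∈ Ioo (1 : ℝ) 2)
    (ξ : EuclideanSpace ℝ (Fin d)) :
    ∫⁻ u, ENNReal.ofReal (1 - Real.cos ⟪ξ, u⟫) ∂(stableLevy d α) =
      ENNReal.ofReal (‖ξ‖ ^ α / 2) := by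
  have hc := stableCst_pos (d := d) hα
  have hα1 : 0 < α := by linarith [hα.1]
  have hp : 0 < ((d : ℝ) + α) / 2 := by positivity
  have hΓ := Real.Gamma_pos_of_pos hp
  rw [stableLevy, lintegral_withDensity_eq_lintegral_mul _
    (measurable_stableLevy_density d α).ennreal_ofReal (by fun_prop)]
  set κ := stableCst d α / Real.Gamma ((d + α) / 2) with hκ
  have hκ0 : 0 < κ := by positivity
  have hcos : ∀ u : EuclideanSpace ℝ (Fin d), 0 ≤ 1 - Real.cos ⟪ξ, u⟫ :=
    fun u => sub_nonneg.2 (Real.cos_le_one _)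
  have h1 : ∀ u : EuclideanSpace ℝ (Fin d),
      ENNReal.ofReal (stableCst d α / ‖u‖ ^ ((d : ℝ) + α)) * ENNReal.ofReal (1 - Real.cos ⟪ξ, u⟫) =
      ∫⁻ t in Ioi (0 : ℝ), ENNReal.ofReal κ * (ENNReal.ofReal (t ^ (((d : ℝ) + α) / 2 - 1)) *
        ENNReal.ofReal (Real.exp (-(‖u‖ ^ 2 * t)) * (1 - Real.cos ⟪ξ, u⟫))) := by
    intro u
    rcases eq_or_ne u 0 with rfl | hu
    · simp
    have hu : 0 < ‖u‖ := norm_pos_iff.2 hu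
    have h2 : ∀ t ∈ Ioi (0 : ℝ), ENNReal.ofReal κ * (ENNReal.ofReal (t ^ (((d : ℝ) + α) / 2 - 1)) *
        ENNReal.ofReal (Real.exp (-(‖u‖ ^ 2 * t)) * (1 - Real.cos ⟪ξ, u⟫))) =
        ENNReal.ofReal (κ * (1 - Real.cos ⟪ξ, u⟫)) *
        ENNReal.ofReal (t ^ (((d : ℝ) + α) / 2 - 1) * Real.exp (-(‖u‖ ^ 2 * t))) := by
      intro t ht
      have ht : 0 < t := ht
      rw [← ENNReal.ofReal_mul (by positivity), ← ENNReal.ofReal_mul (by positivity),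
        ← ENNReal.ofReal_mul (mul_nonneg hκ0.le (hcos u))]
      congr 1; ring
    rw [setLIntegral_congr_fun measurableSet_Ioi h2, lintegral_const_mul _ (by fun_prop),
      lintegral_rpow_mul_exp_neg hp (by positivity), ← ENNReal.ofReal_mul (by positivity),
      ← ENNReal.ofReal_mul (mul_nonneg hκ0.le (hcos u))]
    congr 1
    have : (1 / ‖u‖ ^ 2) ^ (((d : ℝ) + α) / 2) = 1 / ‖u‖ ^ ((d : ℝ) + α) := by
      rw [Real.div_rpow zero_le_one (by positivity), Real.one_rpow, ← Real.rpow_natCast,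
        ← Real.rpow_mul hu.le]
      congr 2; push_cast; ring
    rw [this, hκ]
    field_simp
  simp only [Pi.mul_apply, h1]
  rw [lintegral_lintegral_swap (by fun_prop)]
  have h3 : ∀ t ∈ Ioi (0 : ℝ), ∫⁻ u : EuclideanSpace ℝ (Fin d), ENNReal.ofReal κ *
      (ENNReal.ofReal (t ^ (((d : ℝ) + α) / 2 - 1)) *
        ENNReal.ofReal (Real.exp (-(‖u‖ ^ 2 * t)) * (1 - Real.cos ⟪ξ, u⟫))) =
      ENNReal.ofReal (κ * Real.pi ^ ((d : ℝ) / 2)) *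
        ENNReal.ofReal (t ^ (α / 2 - 1) * (1 - Real.exp (-(‖ξ‖ ^ 2 / 4 / t)))) := by
    intro t ht
    have ht : 0 < t := ht
    rw [lintegral_const_mul _ (by fun_prop), lintegral_const_mul _ (by fun_prop),
      lintegral_exp_neg_mul_one_sub_cos ht, ← ENNReal.ofReal_mul (by positivity),
      ← ENNReal.ofReal_mul (by positivity), ← ENNReal.ofReal_mul (by positivity)]
    congr 1
    rw [show ((d : ℝ) + α) / 2 - 1 = (d : ℝ) / 2 + (α / 2 - 1) by ring, Real.rpow_add ht,
      Real.div_rpow Real.pi_pos.le ht.le]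
    field_simp
  rw [setLIntegral_congr_fun measurableSet_Ioi h3, lintegral_const_mul _ (by fun_prop),
    lintegral_rpow_mul_one_sub_exp (by linarith) (by linarith [hα.2]) (by positivity),
    ← ENNReal.ofReal_mul (by positivity)]
  congr 1
  have h4 : (‖ξ‖ ^ 2 / 4) ^ (α / 2) = ‖ξ‖ ^ α * (1 / 4) ^ (α / 2) := by
    rw [div_eq_mul_one_div, Real.mul_rpow (by positivity) (by positivity), ← Real.rpow_natCast,
      ← Real.rpow_mul (norm_nonneg _)]
    congr 2; push_cast; ring
  have := stableCst_mul_eq (d := d) hα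
  rw [h4]
  calc _ = ‖ξ‖ ^ α * (κ * (Real.pi ^ ((d : ℝ) / 2) *
      (Real.Gamma (1 - α / 2) * ((1 / 4) ^ (α / 2) / (α / 2))))) := by ring
    _ = _ := by rw [this]; ring

instance (d : ℕ) (α : ℝ) : SFinite (stableLevy d α) := by
  unfold stableLevy; infer_instance

lemma integral_stableLevy_comp_neg {d : ℕ} {α : ℝ} (F : EuclideanSpace ℝ (Fin d) → ℝ) :
    ∫ u, F (-u) ∂(stableLevy d α) = ∫ u, F u ∂(stableLevy d α) := by
  rw [stableLevy, integral_withDensity_eq_integral_toReal_smul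
      (measurable_stableLevy_density d α).ennreal_ofReal (by simp),
    integral_withDensity_eq_integral_toReal_smul
      (measurable_stableLevy_density d α).ennreal_ofReal (by simp),
    ← integral_neg_eq_self]
  simp

/-- The weight `min (‖u‖², ‖u‖)` controlling all jump integrals below. -/
lemma integrable_min_stableLevy {d : ℕ} (hd : 0 < d) {α : ℝ} (hα : α ∈ Ioo (1 : ℝ) 2) :
    Integrable (fun u => min (‖u‖ ^ 2) ‖u‖) (stableLevy d α) := by
  have hc := stableCst_pos (d := d) hα
  have : Nonempty (Fin d) := ⟨⟨0, hd⟩⟩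
  rw [stableLevy, integrable_withDensity_iff_integrable_smul'
    (measurable_stableLevy_density d α).ennreal_ofReal (by simp)]
  have h0 : ∀ u : EuclideanSpace ℝ (Fin d),
      (ENNReal.ofReal (stableCst d α / ‖u‖ ^ ((d : ℝ) + α))).toReal =
        stableCst d α / ‖u‖ ^ ((d : ℝ) + α) := fun u => ENNReal.toReal_ofReal (by positivity)
  simp only [h0]
  rw [integrable_fun_norm_addHaar volume
    (f := fun y : ℝ => (stableCst d α / y ^ ((d : ℝ) + α)) • min (y ^ 2) y),
    finrank_euclideanSpace_fin, ← Ioc_union_Ioi_eq_Ioi zero_le_one]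
  have hpow : ∀ y : ℝ, 0 < y → ∀ b : ℝ, y ^ (d - 1) * (stableCst d α / y ^ ((d : ℝ) + α) * y ^ b) =
      stableCst d α * y ^ (b - 1 - α) := by
    intro y hy b
    have : y ^ (d - 1) = y ^ ((d : ℝ) - 1) := by
      rw [← Real.rpow_natCast]; congr 1; push_cast [Nat.cast_sub (Nat.succ_le_of_lt hd)]; ring
    have h2 : y ^ (b - 1 - α) = y ^ ((d : ℝ) - 1) * y ^ b / y ^ ((d : ℝ) + α) := by
      rw [← Real.rpow_add hy, ← Real.rpow_sub hy]; congr 1; ring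
    rw [this, h2]
    ring
  refine IntegrableOn.union ?_ ?_
  · have := (intervalIntegral.intervalIntegrable_rpow' (a := 0) (b := 1) (r := 1 - α)
      (by linarith [hα.2])).const_mul (stableCst d α)
    rw [intervalIntegrable_iff_integrableOn_Ioc_of_le zero_le_one] at this
    refine this.congr_fun (fun y hy => ?_) measurableSet_Ioc
    have h := hpow y hy.1 2
    simp only [smul_eq_mul]
    rw [min_eq_left (by nlinarith [hy.1, hy.2]), ← Real.rpow_two, h]
    norm_num
  · have := (integrableOn_Ioi_rpow_of_lt (a := -α) (by linarith [hα.1]) zero_lt_one).const_mul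
      (stableCst d α)
    refine IntegrableOn.congr_fun this (fun y hy => ?_) measurableSet_Ioi
    have hy : 1 < y := hy
    have h := hpow y (by linarith) 1
    simp only [smul_eq_mul]
    rw [min_eq_right (by nlinarith), ← Real.rpow_one y, ← Real.rpow_mul (by linarith)]
    simp only [Real.rpow_one, one_mul] at h ⊢
    rw [h]
    norm_num

lemma one_sub_cos_inner_le {d : ℕ} (ξ u : EuclideanSpace ℝ (Fin d)) :
    1 - Real.cos ⟪ξ, u⟫ ≤ (‖ξ‖ ^ 2 + 2 * ‖ξ‖) * min (‖u‖ ^ 2) ‖u‖ := by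
  have hi := abs_real_inner_le_norm ξ u
  have hu := norm_nonneg u
  have hξ := norm_nonneg ξ
  have h1 : 1 - Real.cos ⟪ξ, u⟫ ≤ ‖ξ‖ ^ 2 * ‖u‖ ^ 2 := by
    have := Real.one_sub_sq_div_two_le_cos (x := ⟪ξ, u⟫)
    have h2 : ⟪ξ, u⟫ ^ 2 ≤ (‖ξ‖ * ‖u‖) ^ 2 := sq_le_sq.2 (by rwa [abs_of_nonneg (by positivity : 0 ≤ ‖ξ‖ * ‖u‖)])
    nlinarith [sq_nonneg ⟪ξ, u⟫]
  have h2 : 1 - Real.cos ⟪ξ, u⟫ ≤ 2 * ‖ξ‖ * ‖u‖ := by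
    rcases le_total (‖ξ‖ * ‖u‖) 1 with h | h
    · nlinarith [mul_nonneg hξ hu]
    · nlinarith [Real.neg_one_le_cos ⟪ξ, u⟫]
  rcases le_total (‖u‖ ^ 2) ‖u‖ with h | h
  · rw [min_eq_left h]; nlinarith [mul_nonneg hξ (sq_nonneg ‖u‖)]
  · rw [min_eq_right h]; nlinarith [mul_nonneg (sq_nonneg ‖ξ‖) hu]

lemma integrable_one_sub_cos_stableLevy {d : ℕ} (hd : 0 < d) {α : ℝ} (hα : α ∈ Ioo (1 : ℝ) 2)
    (ξ : EuclideanSpace ℝ (Fin d)) :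
    Integrable (fun u => 1 - Real.cos ⟪ξ, u⟫) (stableLevy d α) := by
  refine ((integrable_min_stableLevy hd hα).const_mul (‖ξ‖ ^ 2 + 2 * ‖ξ‖)).mono'
    (by fun_prop) (Eventually.of_forall fun u => ?_)
  rw [Real.norm_of_nonneg (sub_nonneg.2 (Real.cos_le_one _))]
  exact one_sub_cos_inner_le ξ u

lemma integral_one_sub_cos_stableLevy {d : ℕ} {α : ℝ} (hα : α ∈ Ioo (1 : ℝ) 2)
    (ξ : EuclideanSpace ℝ (Fin d)) :
    ∫ u, (1 - Real.cos ⟪ξ, u⟫) ∂(stableLevy d α) = ‖ξ‖ ^ α / 2 := by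
  rw [integral_eq_lintegral_of_nonneg_ae
    (Eventually.of_forall fun u => sub_nonneg.2 (Real.cos_le_one _)) (by fun_prop),
    lintegral_one_sub_cos_stableLevy hα, ENNReal.toReal_ofReal (by positivity)]
section Stein

variable {d : ℕ} {α : ℝ} {μ : Measure (EuclideanSpace ℝ (Fin d))}

lemma abs_jump_mul_jump_le {f g : EuclideanSpace ℝ (Fin d) → ℝ} {L K : ℝ≥0} {M : ℝ}
    (hf : LipschitzWith L f) (hM : ∀ x, |f x| ≤ M) (hg : LipschitzWith K g)
    (x u : EuclideanSpace ℝ (Fin d)) :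
    |(f (x + u) - f x) * (g (x + u) - g x)| ≤ (L + 2 * M) * K * min (‖u‖ ^ 2) ‖u‖ := by
  have hM0 : 0 ≤ M := (abs_nonneg _).trans (hM 0)
  have h1 : |f (x + u) - f x| ≤ L * ‖u‖ := by
    simpa [Real.dist_eq, dist_eq_norm] using hf.dist_le_mul (x + u) x
  have h2 : |g (x + u) - g x| ≤ K * ‖u‖ := by
    simpa [Real.dist_eq, dist_eq_norm] using hg.dist_le_mul (x + u) x
  have h3 : |f (x + u) - f x| ≤ 2 * M := by
    have := abs_sub (f (x + u)) (f x)
    linarith [hM (x + u), hM x]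
  have hu := norm_nonneg u
  have hK := K.2
  have hL := L.2
  rw [abs_mul]
  rcases le_total (‖u‖ ^ 2) ‖u‖ with h | h
  · rw [min_eq_left h]
    calc _ ≤ (L * ‖u‖) * (K * ‖u‖) := by gcongr
      _ ≤ (L * ‖u‖) * (K * ‖u‖) + 2 * M * K * ‖u‖ ^ 2 := le_add_of_nonneg_right (by positivity)
      _ = _ := by ring
  · rw [min_eq_right h]
    calc _ ≤ (2 * M) * (K * ‖u‖) := by gcongr
      _ ≤ (2 * M) * (K * ‖u‖) + L * K * ‖u‖ := le_add_of_nonneg_right (by positivity)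
      _ = _ := by ring

lemma integrable_jump_mul_jump (hd : 0 < d) (hα : α ∈ Ioo (1 : ℝ) 2) [IsProbabilityMeasure μ]
    {f g : EuclideanSpace ℝ (Fin d) → ℝ} {L K : ℝ≥0} {M : ℝ}
    (hf : LipschitzWith L f) (hM : ∀ x, |f x| ≤ M) (hg : LipschitzWith K g) :
    Integrable (fun z : EuclideanSpace ℝ (Fin d) × EuclideanSpace ℝ (Fin d) =>
      (f (z.1 + z.2) - f z.1) * (g (z.1 + z.2) - g z.1)) (μ.prod (stableLevy d α)) := by
  have hfc := hf.continuous
  have hgc := hg.continuous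
  refine (((integrable_min_stableLevy hd hα).const_mul ((L + 2 * M) * K)).comp_snd μ).mono'
    (by fun_prop) (Eventually.of_forall fun z => ?_)
  exact abs_jump_mul_jump_le hf hM hg z.1 z.2

/-- The Dirichlet form as an integral against the product measure. -/
def jumpForm (να μ : Measure (EuclideanSpace ℝ (Fin d)))
    (f g : EuclideanSpace ℝ (Fin d) → ℝ) : ℝ :=
  ∫ z, (f (z.1 + z.2) - f z.1) * (g (z.1 + z.2) - g z.1) ∂(μ.prod να)

lemma Eform_eq_jumpForm (hd : 0 < d) (hα : α ∈ Ioo (1 : ℝ) 2) [IsProbabilityMeasure μ]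
    {f g : EuclideanSpace ℝ (Fin d) → ℝ} {L K : ℝ≥0} {M : ℝ}
    (hf : LipschitzWith L f) (hM : ∀ x, |f x| ≤ M) (hg : LipschitzWith K g) :
    Eform (stableLevy d α) μ f g = jumpForm (stableLevy d α) μ f g :=
  (integral_prod _ (integrable_jump_mul_jump hd hα hf hM hg)).symm

lemma integral_add_mul_add_mul {X : Type*} [MeasurableSpace X] {m : Measure X} {F G H : X → ℝ}
    (hF : Integrable F m) (hG : Integrable G m) (hH : Integrable H m) (a b : ℝ) :
    ∫ x, (F x + a * G x + b * H x) ∂m = ∫ x, F x ∂m + a * ∫ x, G x ∂m + b * ∫ x, H x ∂m := by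
  have h : Integrable (fun x => F x + a * G x) m := hF.add (hG.const_mul a)
  rw [integral_add h (hH.const_mul b), integral_add hF (hG.const_mul a), integral_const_mul,
    integral_const_mul]

lemma integrable_of_lipschitz_bounded [IsProbabilityMeasure μ]
    {f : EuclideanSpace ℝ (Fin d) → ℝ} {L : ℝ≥0} {M : ℝ}
    (hf : LipschitzWith L f) (hM : ∀ x, |f x| ≤ M) : Integrable f μ :=
  Integrable.of_bound hf.continuous.aestronglyMeasurable M (Eventually.of_forall hM)

lemma integrable_mul_of_lipschitz_bounded [IsProbabilityMeasure μ]
    {f g : EuclideanSpace ℝ (Fin d) → ℝ} {L K : ℝ≥0} {M N : ℝ}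
    (hf : LipschitzWith L f) (hM : ∀ x, |f x| ≤ M)
    (hg : LipschitzWith K g) (hN : ∀ x, |g x| ≤ N) : Integrable (fun x => f x * g x) μ :=
  Integrable.of_bound (hf.continuous.mul hg.continuous).aestronglyMeasurable (M * N)
    (Eventually.of_forall fun x => by
      rw [norm_mul]
      exact mul_le_mul (hM x) (hN x) (abs_nonneg _) ((abs_nonneg _).trans (hM x)))

/-- Cauchy–Schwarz for the nonnegative form given by the deficit in a Poincaré inequality. -/
lemma sq_deficit_le (hd : 0 < d) (hα : α ∈ Ioo (1 : ℝ) 2) [IsProbabilityMeasure μ] {U : ℝ}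
    (hP : ∀ f : EuclideanSpace ℝ (Fin d) → ℝ,
      (∃ K : ℝ≥0, LipschitzWith K f) → (∃ M : ℝ, ∀ x, |f x| ≤ M) →
      (∫ x, f x ∂μ) = 0 → ∫ x, (f x) ^ 2 ∂μ ≤ U * Eform (stableLevy d α) μ f f)
    {f g : EuclideanSpace ℝ (Fin d) → ℝ} {L K : ℝ≥0} {M N : ℝ}
    (hf : LipschitzWith L f) (hM : ∀ x, |f x| ≤ M) (hf0 : ∫ x, f x ∂μ = 0)
    (hg : LipschitzWith K g) (hN : ∀ x, |g x| ≤ N) (hg0 : ∫ x, g x ∂μ = 0) :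
    (U * jumpForm (stableLevy d α) μ f g - ∫ x, f x * g x ∂μ) ^ 2 ≤
      (U * Eform (stableLevy d α) μ f f - ∫ x, (f x) ^ 2 ∂μ) *
      (U * Eform (stableLevy d α) μ g g - ∫ x, (g x) ^ 2 ∂μ) := by
  set ν := stableLevy d α
  have key : ∀ t : ℝ, 0 ≤ (U * Eform ν μ g g - ∫ x, (g x) ^ 2 ∂μ) * (t * t) +
      (2 * (U * jumpForm ν μ f g - ∫ x, f x * g x ∂μ)) * t +
      (U * Eform ν μ f f - ∫ x, (f x) ^ 2 ∂μ) := by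
    intro t
    have hlip : LipschitzWith (L + ‖t‖₊ * K) (fun x => f x + t * g x) :=
      hf.add ((lipschitzWith_smul t).comp hg)
    have hbd : ∀ x, |f x + t * g x| ≤ M + |t| * N := fun x => by
      refine (abs_add_le _ _).trans ?_
      rw [abs_mul]
      exact add_le_add (hM x) (mul_le_mul_of_nonneg_left (hN x) (abs_nonneg t))
    have hmean : ∫ x, (f x + t * g x) ∂μ = 0 := by
      rw [integral_add (integrable_of_lipschitz_bounded hf hM)
        ((integrable_of_lipschitz_bounded hg hN).const_mul t), integral_const_mul, hf0, hg0]
      simp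
    have h := hP _ ⟨_, hlip⟩ ⟨_, hbd⟩ hmean
    have hE : Eform ν μ (fun x => f x + t * g x) (fun x => f x + t * g x) =
        jumpForm ν μ f f + 2 * t * jumpForm ν μ f g + t * t * jumpForm ν μ g g := by
      have i1 := integrable_jump_mul_jump (μ := μ) hd hα hf hM hf
      have i2 := integrable_jump_mul_jump (μ := μ) hd hα hf hM hg
      have i3 := integrable_jump_mul_jump (μ := μ) hd hα hg hN hg
      rw [Eform_eq_jumpForm hd hα hlip hbd hlip]
      refine Eq.trans ?_ (integral_add_mul_add_mul i1 i2 i3 (2 * t) (t * t))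
      simp only [jumpForm]
      congr 1; ext z; ring
    have hV : ∫ x, (f x + t * g x) ^ 2 ∂μ =
        ∫ x, (f x) ^ 2 ∂μ + 2 * t * ∫ x, f x * g x ∂μ + t * t * ∫ x, (g x) ^ 2 ∂μ := by
      have i1 := integrable_mul_of_lipschitz_bounded (μ := μ) hf hM hf hM
      have i2 := integrable_mul_of_lipschitz_bounded (μ := μ) hf hM hg hN
      have i3 := integrable_mul_of_lipschitz_bounded (μ := μ) hg hN hg hN
      simp only [pow_two]
      rw [← integral_add_mul_add_mul i1 i2 i3]
      congr 1; ext z; ring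
    rw [hE, hV] at h
    rw [Eform_eq_jumpForm hd hα hf hM hf, Eform_eq_jumpForm hd hα hg hN hg]
    linarith
  have := discrim_le_zero key
  rw [discrim] at this
  nlinarith

lemma lipschitzWith_coord_mul_exp (j : Fin d) :
    LipschitzWith 3 (fun x : EuclideanSpace ℝ (Fin d) => x j * Real.exp (-‖x‖ ^ 2)) := by
  have hder : ∀ x : EuclideanSpace ℝ (Fin d), HasFDerivAt
      (fun x : EuclideanSpace ℝ (Fin d) => x j * Real.exp (-‖x‖ ^ 2))
      (x j • (Real.exp (-‖x‖ ^ 2) • -(2 • innerSL ℝ x)) +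
        Real.exp (-‖x‖ ^ 2) • (EuclideanSpace.proj j : EuclideanSpace ℝ (Fin d) →L[ℝ] ℝ)) x := by
    intro x
    exact (EuclideanSpace.proj j : EuclideanSpace ℝ (Fin d) →L[ℝ] ℝ).hasFDerivAt.mul
      (hasStrictFDerivAt_norm_sq x).hasFDerivAt.neg.exp
  refine lipschitzWith_of_nnnorm_fderiv_le (𝕜 := ℝ) (fun x => (hder x).differentiableAt) fun x => ?_
  rw [(hder x).fderiv, ← NNReal.coe_le_coe, coe_nnnorm]
  have hx : ‖x j‖ ≤ ‖x‖ := PiLp.norm_apply_le x j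
  have hproj : ‖(EuclideanSpace.proj j : EuclideanSpace ℝ (Fin d) →L[ℝ] ℝ)‖ ≤ 1 :=
    ContinuousLinearMap.opNorm_le_bound _ zero_le_one fun y => by
      simpa using PiLp.norm_apply_le y j
  have he1 : Real.exp (-‖x‖ ^ 2) ≤ 1 := Real.exp_le_one_iff.2 (by nlinarith [norm_nonneg x])
  have he2 : ‖x‖ ^ 2 * Real.exp (-‖x‖ ^ 2) ≤ 1 := by
    rw [Real.exp_neg, ← div_eq_mul_inv, div_le_one (Real.exp_pos _)]
    linarith [Real.add_one_le_exp (‖x‖ ^ 2)]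
  have hi : ‖(2 • innerSL ℝ x : EuclideanSpace ℝ (Fin d) →L[ℝ] ℝ)‖ ≤ 2 * ‖x‖ := by
    refine (norm_nsmul_le).trans ?_
    simp
  calc _ ≤ ‖x j‖ * (Real.exp (-‖x‖ ^ 2) * ‖(2 • innerSL ℝ x : EuclideanSpace ℝ (Fin d) →L[ℝ] ℝ)‖) +
        Real.exp (-‖x‖ ^ 2) * ‖(EuclideanSpace.proj j : EuclideanSpace ℝ (Fin d) →L[ℝ] ℝ)‖ := by
        refine (norm_add_le _ _).trans (le_of_eq ?_)
        rw [norm_smul, norm_smul, norm_smul, norm_neg, Real.norm_of_nonneg (Real.exp_pos _).le]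
    _ ≤ ‖x‖ * (Real.exp (-‖x‖ ^ 2) * (2 * ‖x‖)) + 1 * 1 := by gcongr
    _ = 2 * (‖x‖ ^ 2 * Real.exp (-‖x‖ ^ 2)) + 1 := by ring
    _ ≤ 3 := by linarith

lemma lipschitzWith_gTruncC {R : ℝ} (hR : 0 < R) (j : Fin d) :
    LipschitzWith 3 (gTruncC μ R j) := by
  refine LipschitzWith.of_dist_le_mul fun x y => ?_
  have h := (lipschitzWith_coord_mul_exp j).dist_le_mul (R⁻¹ • x) (R⁻¹ • y)
  have hx : ∀ x, gTruncC μ R j x = R * ((R⁻¹ • x) j * Real.exp (-‖R⁻¹ • x‖ ^ 2)) -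
      ∫ y, y j * Real.exp (-‖R⁻¹ • y‖ ^ 2) ∂μ := fun x => by
    simp only [gTruncC, PiLp.smul_apply, smul_eq_mul]
    field_simp
  rw [hx, hx, dist_sub_right, Real.dist_eq, ← mul_sub, abs_mul, abs_of_pos hR, ← Real.dist_eq]
  rw [dist_smul₀, Real.norm_of_nonneg (by positivity)] at h
  calc _ ≤ R * (_ * (R⁻¹ * dist x y)) := mul_le_mul_of_nonneg_left h hR.le
    _ = _ := by field_simp

lemma abs_coord_mul_exp_le_norm (R : ℝ) (j : Fin d) (x : EuclideanSpace ℝ (Fin d)) :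
    |x j * Real.exp (-‖R⁻¹ • x‖ ^ 2)| ≤ ‖x‖ := by
  rw [abs_mul, abs_of_pos (Real.exp_pos _)]
  have h1 : |x j| ≤ ‖x‖ := PiLp.norm_apply_le x j
  have h2 : Real.exp (-‖R⁻¹ • x‖ ^ 2) ≤ 1 := Real.exp_le_one_iff.2 (by nlinarith [norm_nonneg (R⁻¹ • x)])
  calc _ ≤ ‖x‖ * 1 := by gcongr
    _ = _ := mul_one _

lemma abs_gTruncC_le {R : ℝ} (hR : 0 < R) (j : Fin d) (x : EuclideanSpace ℝ (Fin d)) :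
    |gTruncC μ R j x| ≤ R + |∫ y, y j * Real.exp (-‖R⁻¹ • y‖ ^ 2) ∂μ| := by
  refine (abs_sub _ _).trans (add_le_add_left ?_ _)
  rw [abs_mul, abs_of_pos (Real.exp_pos _)]
  have h1 : |x j| ≤ ‖x‖ := PiLp.norm_apply_le x j
  have h2 : ‖x‖ = R * ‖R⁻¹ • x‖ := by
    rw [norm_smul, Real.norm_of_nonneg (by positivity)]; field_simp
  set s := ‖R⁻¹ • x‖
  have h3 : s * Real.exp (-s ^ 2) ≤ 1 := by
    rw [Real.exp_neg, ← div_eq_mul_inv, div_le_one (Real.exp_pos _)]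
    nlinarith [Real.add_one_le_exp (s ^ 2), sq_nonneg (s - 1)]
  calc _ ≤ (R * s) * Real.exp (-s ^ 2) := by rw [← h2]; gcongr
    _ = R * (s * Real.exp (-s ^ 2)) := by ring
    _ ≤ R * 1 := by gcongr
    _ = R := mul_one _

lemma tendsto_exp_neg_norm_inv_smul (x : EuclideanSpace ℝ (Fin d)) :
    Tendsto (fun R : ℝ => Real.exp (-‖R⁻¹ • x‖ ^ 2)) atTop (𝓝 1) := by
  have : Tendsto (fun R : ℝ => Real.exp (-‖R⁻¹ • x‖ ^ 2)) atTop
      (𝓝 (Real.exp (-‖(0 : ℝ) • x‖ ^ 2))) := by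
    have h := ((tendsto_inv_atTop_zero (𝕜 := ℝ)).smul_const x)
    exact (Real.continuous_exp.tendsto _).comp ((h.norm.pow 2).neg)
  simpa using this

/-- Approximate extremality of the truncated coordinates turns the Poincaré inequality into an
integration by parts formula. -/
lemma stein_identity_coord (hd : 0 < d) (hα : α ∈ Ioo (1 : ℝ) 2) [IsProbabilityMeasure μ]
    (hint : Integrable (fun x => x) μ) (hcent : ∫ x, x ∂μ = 0) {U : ℝ}
    (hP : ∀ f : EuclideanSpace ℝ (Fin d) → ℝ,
      (∃ K : ℝ≥0, LipschitzWith K f) → (∃ M : ℝ, ∀ x, |f x| ≤ M) →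
      (∫ x, f x ∂μ) = 0 → ∫ x, (f x) ^ 2 ∂μ ≤ U * Eform (stableLevy d α) μ f f)
    (j : Fin d)
    (hlim : Tendsto (fun R : ℝ =>
      U * Eform (stableLevy d α) μ (gTruncC μ R j) (gTruncC μ R j)
        - ∫ x, (gTruncC μ R j x) ^ 2 ∂μ) atTop (𝓝 0))
    {f : EuclideanSpace ℝ (Fin d) → ℝ} {L : ℝ≥0} {M : ℝ}
    (hf : LipschitzWith L f) (hM : ∀ x, |f x| ≤ M) (hf0 : ∫ x, f x ∂μ = 0) :
    ∫ x, f x * x j ∂μ =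
      U * ∫ z, (f (z.1 + z.2) - f z.1) * z.2 j ∂(μ.prod (stableLevy d α)) := by
  set ν := stableLevy d α
  have hfc := hf.continuous
  have hM0 : 0 ≤ M := (abs_nonneg _).trans (hM 0)
  have hj0 : ∫ x, x j ∂μ = 0 := by
    have := (EuclideanSpace.proj j : EuclideanSpace ℝ (Fin d) →L[ℝ] ℝ).integral_comp_comm hint
    rw [hcent, map_zero] at this
    simpa using this
  set c : ℝ → ℝ := fun R => ∫ y, y j * Real.exp (-‖R⁻¹ • y‖ ^ 2) ∂μ with hc
  have hc_lim : Tendsto c atTop (𝓝 0) := by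
    rw [← hj0]
    refine tendsto_integral_filter_of_dominated_convergence (fun y => ‖y‖) ?_ ?_ hint.norm ?_
    · exact Eventually.of_forall fun R => Continuous.aestronglyMeasurable (by fun_prop)
    · exact Eventually.of_forall fun R => Eventually.of_forall fun y =>
        abs_coord_mul_exp_le_norm R j y
    · exact Eventually.of_forall fun y => by
        simpa using (tendsto_exp_neg_norm_inv_smul y).const_mul (y j)
  have hc_le : ∀ R, |c R| ≤ ∫ y, ‖y‖ ∂μ := fun R =>
    norm_integral_le_of_norm_le
      (f := fun y : EuclideanSpace ℝ (Fin d) => y j * Real.exp (-‖R⁻¹ • y‖ ^ 2)) hint.norm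
      (Eventually.of_forall fun y => abs_coord_mul_exp_le_norm R j y)
  have hg : ∀ R x, gTruncC μ R j x = x j * Real.exp (-‖R⁻¹ • x‖ ^ 2) - c R := fun _ _ => rfl
  have hg_lim : ∀ x, Tendsto (fun R => gTruncC μ R j x) atTop (𝓝 (x j)) := fun x => by
    simpa [hg] using ((tendsto_exp_neg_norm_inv_smul x).const_mul (x j)).sub hc_lim
  have hg_cont : ∀ R, Continuous (gTruncC μ R j) := fun R => by
    unfold gTruncC; fun_prop
  have hg0 : ∀ R, ∫ x, gTruncC μ R j x ∂μ = 0 := fun R => by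
    simp only [hg]
    have hi : Integrable (fun x : EuclideanSpace ℝ (Fin d) =>
        x j * Real.exp (-‖R⁻¹ • x‖ ^ 2)) μ :=
      hint.norm.mono' (Continuous.aestronglyMeasurable (by fun_prop))
        (Eventually.of_forall fun y => abs_coord_mul_exp_le_norm R j y)
    rw [integral_sub hi (integrable_const _)]
    simp [hc]
  have hJ : Tendsto (fun R => jumpForm ν μ f (gTruncC μ R j)) atTop
      (𝓝 (∫ z, (f (z.1 + z.2) - f z.1) * z.2 j ∂(μ.prod ν))) := by
    refine tendsto_integral_filter_of_dominated_convergence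
      (fun z => (L + 2 * M) * (3 : ℝ≥0) * min (‖z.2‖ ^ 2) ‖z.2‖) ?_ ?_
      (((integrable_min_stableLevy hd hα).const_mul ((L + 2 * M) * (3 : ℝ≥0))).comp_snd μ) ?_
    · refine Eventually.of_forall fun R => Continuous.aestronglyMeasurable ?_
      have := hg_cont R
      fun_prop
    · filter_upwards [eventually_gt_atTop 0] with R hR
      exact Eventually.of_forall fun z =>
        abs_jump_mul_jump_le hf hM (lipschitzWith_gTruncC hR j) z.1 z.2
    · refine Eventually.of_forall fun z => Tendsto.const_mul _ ?_
      simpa using (hg_lim (z.1 + z.2)).sub (hg_lim z.1)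
  have hV : Tendsto (fun R => ∫ x, f x * gTruncC μ R j x ∂μ) atTop (𝓝 (∫ x, f x * x j ∂μ)) := by
    refine tendsto_integral_filter_of_dominated_convergence
      (fun x => M * (‖x‖ + ∫ y, ‖y‖ ∂μ)) ?_ ?_
      ((hint.norm.add (integrable_const _)).const_mul M) ?_
    · refine Eventually.of_forall fun R => Continuous.aestronglyMeasurable ?_
      have := hg_cont R
      fun_prop
    · refine Eventually.of_forall fun R => Eventually.of_forall fun x => ?_
      rw [norm_mul]
      refine mul_le_mul (hM x) ?_ (norm_nonneg _) hM0
      exact (abs_sub _ _).trans (add_le_add (abs_coord_mul_exp_le_norm R j x) (hc_le R))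
    · exact Eventually.of_forall fun x => (hg_lim x).const_mul _
  have h1 := (((hJ.const_mul U).sub hV).pow 2)
  have h2 := hlim.const_mul (U * Eform ν μ f f - ∫ x, (f x) ^ 2 ∂μ)
  have h3 := le_of_tendsto_of_tendsto h1 h2 (by
    filter_upwards [eventually_gt_atTop 0] with R hR
    exact sq_deficit_le hd hα hP hf hM hf0 (lipschitzWith_gTruncC hR j)
      (abs_gTruncC_le hR j) (hg0 R))
  rw [mul_zero] at h3
  have := pow_eq_zero_iff (two_ne_zero) |>.1 (le_antisymm h3 (sq_nonneg _))
  linarith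

lemma stein_identity (hd : 0 < d) (hα : α ∈ Ioo (1 : ℝ) 2) [IsProbabilityMeasure μ]
    (hint : Integrable (fun x => x) μ) (hcent : ∫ x, x ∂μ = 0) {U : ℝ}
    (hP : ∀ f : EuclideanSpace ℝ (Fin d) → ℝ,
      (∃ K : ℝ≥0, LipschitzWith K f) → (∃ M : ℝ, ∀ x, |f x| ≤ M) →
      (∫ x, f x ∂μ) = 0 → ∫ x, (f x) ^ 2 ∂μ ≤ U * Eform (stableLevy d α) μ f f)
    (hlim : ∀ j, Tendsto (fun R : ℝ =>
      U * Eform (stableLevy d α) μ (gTruncC μ R j) (gTruncC μ R j)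
        - ∫ x, (gTruncC μ R j x) ^ 2 ∂μ) atTop (𝓝 0))
    {f : EuclideanSpace ℝ (Fin d) → ℝ} {L : ℝ≥0} {M : ℝ}
    (hf : LipschitzWith L f) (hM : ∀ x, |f x| ≤ M) (ξ : EuclideanSpace ℝ (Fin d)) :
    ∫ x, f x * ⟪ξ, x⟫ ∂μ =
      U * ∫ z, (f (z.1 + z.2) - f z.1) * ⟪ξ, z.2⟫ ∂(μ.prod (stableLevy d α)) := by
  set m := ∫ x, f x ∂μ with hm
  have hfc := hf.continuous
  have hlip : LipschitzWith L (fun x => f x - m) := by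
    refine LipschitzWith.of_dist_le_mul fun x y => ?_
    rw [dist_sub_right]; exact hf.dist_le_mul x y
  have hbd : ∀ x, |f x - m| ≤ M + |m| := fun x =>
    (abs_sub _ _).trans (add_le_add_left (hM x) _)
  have hfi := integrable_of_lipschitz_bounded (μ := μ) hf hM
  have hmean : ∫ x, (f x - m) ∂μ = 0 := by
    rw [integral_sub hfi (integrable_const _)]; simp [hm]
  have hjint : ∀ j, Integrable (fun x : EuclideanSpace ℝ (Fin d) => x j) μ := fun j =>
    (EuclideanSpace.proj j : EuclideanSpace ℝ (Fin d) →L[ℝ] ℝ).integrable_comp hint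
  have hj0 : ∀ j, ∫ x, x j ∂μ = 0 := fun j => by
    have := (EuclideanSpace.proj j : EuclideanSpace ℝ (Fin d) →L[ℝ] ℝ).integral_comp_comm hint
    rw [hcent, map_zero] at this
    simpa using this
  have hfj : ∀ j, Integrable (fun x => f x * x j) μ := fun j =>
    (hjint j).bdd_mul hfc.aestronglyMeasurable (Eventually.of_forall hM)
  have hcoord : ∀ j, ∫ x, f x * x j ∂μ =
      U * ∫ z, (f (z.1 + z.2) - f z.1) * z.2 j ∂(μ.prod (stableLevy d α)) := fun j => by
    have := stein_identity_coord hd hα hint hcent hP j (hlim j) hlip hbd hmean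
    simp only [sub_sub_sub_cancel_right, sub_mul _ m] at this
    rw [← this, integral_sub (hfj j) ((hjint j).const_mul m), integral_const_mul, hj0, mul_zero,
      sub_zero]
  have hfz : ∀ j, Integrable (fun z : EuclideanSpace ℝ (Fin d) × EuclideanSpace ℝ (Fin d) =>
      (f (z.1 + z.2) - f z.1) * z.2 j) (μ.prod (stableLevy d α)) := fun j => by
    have hl : LipschitzWith 1 (fun x : EuclideanSpace ℝ (Fin d) => x j) :=
      LipschitzWith.of_dist_le_mul fun x y => by
        rw [NNReal.coe_one, one_mul, dist_eq_norm, dist_eq_norm]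
        exact PiLp.norm_apply_le (x - y) j
    simpa using integrable_jump_mul_jump (μ := μ) hd hα hf hM hl
  have hinner : ∀ x : EuclideanSpace ℝ (Fin d), ⟪ξ, x⟫ = ∑ j, ξ j * x j := fun x => by
    simp [PiLp.inner_apply, mul_comm]
  simp only [hinner, Finset.mul_sum, mul_left_comm _ (ξ _)]
  rw [integral_finsetSum _ fun j _ => (hfj j).const_mul _,
    integral_finsetSum _ fun j _ => (hfz j).const_mul _, Finset.mul_sum]
  refine Finset.sum_congr rfl fun j _ => ?_
  rw [integral_const_mul, integral_const_mul, hcoord]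
  ring

end Stein
section CharacteristicFunction

variable {d : ℕ} {α : ℝ} {μ : Measure (EuclideanSpace ℝ (Fin d))}

lemma lipschitzWith_inner_left (ξ : EuclideanSpace ℝ (Fin d)) :
    LipschitzWith ‖ξ‖₊ (fun x : EuclideanSpace ℝ (Fin d) => ⟪ξ, x⟫) := by
  have h := (innerSL ℝ ξ).lipschitz
  rwa [show ‖innerSL ℝ ξ‖₊ = ‖ξ‖₊ from NNReal.eq (innerSL_apply_norm ℝ ξ)] at h

lemma lipschitzWith_cos_mul_inner (t : ℝ) (ξ : EuclideanSpace ℝ (Fin d)) :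
    LipschitzWith (1 * (‖t‖₊ * ‖ξ‖₊))
      (fun x : EuclideanSpace ℝ (Fin d) => Real.cos (t * ⟪ξ, x⟫)) :=
  Real.lipschitzWith_cos.comp ((lipschitzWith_smul t).comp (lipschitzWith_inner_left ξ))

lemma lipschitzWith_sin_mul_inner (t : ℝ) (ξ : EuclideanSpace ℝ (Fin d)) :
    LipschitzWith (1 * (‖t‖₊ * ‖ξ‖₊))
      (fun x : EuclideanSpace ℝ (Fin d) => Real.sin (t * ⟪ξ, x⟫)) :=
  Real.lipschitzWith_sin.comp ((lipschitzWith_smul t).comp (lipschitzWith_inner_left ξ))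

lemma abs_sin_mul_inner_le (t : ℝ) (ξ u : EuclideanSpace ℝ (Fin d)) :
    |Real.sin (t * ⟪ξ, u⟫) * ⟪ξ, u⟫| ≤ (|t| * ‖ξ‖ + 2) * ‖ξ‖ * min (‖u‖ ^ 2) ‖u‖ := by
  simpa using abs_jump_mul_jump_le (lipschitzWith_sin_mul_inner t ξ)
    (fun x => Real.abs_sin_le_one _) (lipschitzWith_inner_left ξ) 0 u

lemma integrable_sin_mul_inner (hd : 0 < d) (hα : α ∈ Ioo (1 : ℝ) 2) (t : ℝ)
    (ξ : EuclideanSpace ℝ (Fin d)) :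
    Integrable (fun u => Real.sin (t * ⟪ξ, u⟫) * ⟪ξ, u⟫) (stableLevy d α) :=
  ((integrable_min_stableLevy hd hα).const_mul ((|t| * ‖ξ‖ + 2) * ‖ξ‖)).mono' (by fun_prop)
    (Eventually.of_forall fun u => abs_sin_mul_inner_le t ξ u)

lemma integrable_cos_sub_one_mul_inner (hd : 0 < d) (hα : α ∈ Ioo (1 : ℝ) 2) (t : ℝ)
    (ξ : EuclideanSpace ℝ (Fin d)) :
    Integrable (fun u => (Real.cos (t * ⟪ξ, u⟫) - 1) * ⟪ξ, u⟫) (stableLevy d α) :=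
  ((integrable_min_stableLevy hd hα).const_mul ((|t| * ‖ξ‖ + 2) * ‖ξ‖)).mono' (by fun_prop)
    (Eventually.of_forall fun u => by
      simpa using abs_jump_mul_jump_le (lipschitzWith_cos_mul_inner t ξ)
        (fun x => Real.abs_cos_le_one _) (lipschitzWith_inner_left ξ) 0 u)

lemma integral_cos_sub_one_mul_inner (t : ℝ) (ξ : EuclideanSpace ℝ (Fin d)) :
    ∫ u, (Real.cos (t * ⟪ξ, u⟫) - 1) * ⟪ξ, u⟫ ∂(stableLevy d α) = 0 := by
  have h := integral_stableLevy_comp_neg (d := d) (α := α)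
    (fun u => (Real.cos (t * ⟪ξ, u⟫) - 1) * ⟪ξ, u⟫)
  simp only [inner_neg_right, mul_neg, Real.cos_neg, integral_neg] at h
  linarith

lemma hasDerivAt_integral_one_sub_cos (hd : 0 < d) (hα : α ∈ Ioo (1 : ℝ) 2)
    (ξ : EuclideanSpace ℝ (Fin d)) (t : ℝ) :
    HasDerivAt (fun t => ∫ u, (1 - Real.cos (t * ⟪ξ, u⟫)) ∂(stableLevy d α))
      (∫ u, Real.sin (t * ⟪ξ, u⟫) * ⟪ξ, u⟫ ∂(stableLevy d α)) t := by
  refine (hasDerivAt_integral_of_dominated_loc_of_deriv_le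
    (F := fun t (u : EuclideanSpace ℝ (Fin d)) => 1 - Real.cos (t * ⟪ξ, u⟫))
    (F' := fun t u => Real.sin (t * ⟪ξ, u⟫) * ⟪ξ, u⟫)
    (bound := fun u => ((|t| + 1) * ‖ξ‖ + 2) * ‖ξ‖ * min (‖u‖ ^ 2) ‖u‖)
    (Metric.ball_mem_nhds t one_pos) (Eventually.of_forall fun s => by fun_prop) ?_ (by fun_prop)
    (Eventually.of_forall fun u s hs => ?_) ((integrable_min_stableLevy hd hα).const_mul _)
    (Eventually.of_forall fun u s _ => ?_)).2
  · have := integrable_one_sub_cos_stableLevy hd hα (t • ξ)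
    simpa [inner_smul_left] using this
  · refine (abs_sin_mul_inner_le s ξ u).trans ?_
    have h1 : |s| ≤ |t| + 1 := by
      have h2 := abs_sub_abs_le_abs_sub s t
      have h3 : |s - t| < 1 := by simpa [Real.dist_eq] using hs
      linarith
    gcongr
  · have := (((hasDerivAt_id s).mul_const ⟪ξ, u⟫).cos).const_sub 1
    simpa using this

lemma hasDerivAt_integral_cos_mul_inner [IsProbabilityMeasure μ]
    (hint : Integrable (fun x => x) μ) (ξ : EuclideanSpace ℝ (Fin d)) (t : ℝ) :
    HasDerivAt (fun t => ∫ x, Real.cos (t * ⟪ξ, x⟫) ∂μ)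
      (-∫ x, Real.sin (t * ⟪ξ, x⟫) * ⟪ξ, x⟫ ∂μ) t := by
  rw [← integral_neg]
  refine (hasDerivAt_integral_of_dominated_loc_of_deriv_le
    (F := fun t (x : EuclideanSpace ℝ (Fin d)) => Real.cos (t * ⟪ξ, x⟫))
    (F' := fun t x => -(Real.sin (t * ⟪ξ, x⟫) * ⟪ξ, x⟫)) (bound := fun x => ‖ξ‖ * ‖x‖)
    (Metric.ball_mem_nhds t one_pos) (Eventually.of_forall fun s => by fun_prop) ?_ (by fun_prop)
    (Eventually.of_forall fun x s _ => ?_) (hint.norm.const_mul _)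
    (Eventually.of_forall fun x s _ => ?_)).2
  · exact integrable_of_lipschitz_bounded (lipschitzWith_cos_mul_inner t ξ)
      (fun x => Real.abs_cos_le_one _)
  · rw [norm_neg, norm_mul]
    calc _ ≤ 1 * (‖ξ‖ * ‖x‖) := by
          gcongr
          · exact Real.abs_sin_le_one _
          · exact norm_inner_le_norm ξ x
      _ = _ := one_mul _
  · simpa using ((hasDerivAt_id s).mul_const ⟪ξ, x⟫).cos

lemma hasDerivAt_integral_sin_mul_inner [IsProbabilityMeasure μ]
    (hint : Integrable (fun x => x) μ) (ξ : EuclideanSpace ℝ (Fin d)) (t : ℝ) :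
    HasDerivAt (fun t => ∫ x, Real.sin (t * ⟪ξ, x⟫) ∂μ)
      (∫ x, Real.cos (t * ⟪ξ, x⟫) * ⟪ξ, x⟫ ∂μ) t := by
  refine (hasDerivAt_integral_of_dominated_loc_of_deriv_le
    (F := fun t (x : EuclideanSpace ℝ (Fin d)) => Real.sin (t * ⟪ξ, x⟫))
    (F' := fun t x => Real.cos (t * ⟪ξ, x⟫) * ⟪ξ, x⟫) (bound := fun x => ‖ξ‖ * ‖x‖)
    (Metric.ball_mem_nhds t one_pos) (Eventually.of_forall fun s => by fun_prop) ?_ (by fun_prop)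
    (Eventually.of_forall fun x s _ => ?_) (hint.norm.const_mul _)
    (Eventually.of_forall fun x s _ => ?_)).2
  · exact integrable_of_lipschitz_bounded (lipschitzWith_sin_mul_inner t ξ)
      (fun x => Real.abs_sin_le_one _)
  · rw [norm_mul]
    calc _ ≤ 1 * (‖ξ‖ * ‖x‖) := by
          gcongr
          · exact Real.abs_cos_le_one _
          · exact norm_inner_le_norm ξ x
      _ = _ := one_mul _
  · simpa using ((hasDerivAt_id s).mul_const ⟪ξ, x⟫).sin

lemma eq_mul_exp_neg_of_hasDerivAt {A Ψ m : ℝ → ℝ} {U : ℝ}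
    (hA : ∀ t, HasDerivAt A (-(U * (A t * m t))) t) (hΨ : ∀ t, HasDerivAt Ψ (m t) t)
    (hΨ0 : Ψ 0 = 0) (t : ℝ) : A t = A 0 * Real.exp (-(U * Ψ t)) := by
  have h : ∀ s, HasDerivAt (fun s => A s * Real.exp (U * Ψ s)) 0 s := fun s => by
    have := (hA s).mul ((hΨ s).const_mul U).exp
    convert! this using 1
    ring
  have hc := is_const_of_deriv_eq_zero (fun s => (h s).differentiableAt) (fun s => (h s).deriv) t 0
  simp only [hΨ0, mul_zero, Real.exp_zero, mul_one] at hc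
  rw [← hc, mul_assoc, ← Real.exp_add]
  simp

/-- The integration by parts formula determines the characteristic function. -/
lemma charFn_eq_of_stein (hd : 0 < d) (hα : α ∈ Ioo (1 : ℝ) 2) [IsProbabilityMeasure μ]
    (hint : Integrable (fun x => x) μ) {U : ℝ} (ξ : EuclideanSpace ℝ (Fin d))
    (hS : ∀ (f : EuclideanSpace ℝ (Fin d) → ℝ) (L : ℝ≥0) (M : ℝ), LipschitzWith L f →
      (∀ x, |f x| ≤ M) → ∫ x, f x * ⟪ξ, x⟫ ∂μ =
        U * ∫ z, (f (z.1 + z.2) - f z.1) * ⟪ξ, z.2⟫ ∂(μ.prod (stableLevy d α))) :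
    charFn μ ξ = Complex.exp (-((U * (‖ξ‖ ^ α / 2) : ℝ) : ℂ)) := by
  set m : ℝ → ℝ := fun t => ∫ u, Real.sin (t * ⟪ξ, u⟫) * ⟪ξ, u⟫ ∂(stableLevy d α) with hm
  set A : ℝ → ℝ := fun t => ∫ x, Real.cos (t * ⟪ξ, x⟫) ∂μ with hA
  set B : ℝ → ℝ := fun t => ∫ x, Real.sin (t * ⟪ξ, x⟫) ∂μ with hB
  have hci : ∀ t, Integrable (fun x => Real.cos (t * ⟪ξ, x⟫)) μ := fun t =>
    integrable_of_lipschitz_bounded (lipschitzWith_cos_mul_inner t ξ)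
      (fun x => Real.abs_cos_le_one _)
  have hsi : ∀ t, Integrable (fun x => Real.sin (t * ⟪ξ, x⟫)) μ := fun t =>
    integrable_of_lipschitz_bounded (lipschitzWith_sin_mul_inner t ξ)
      (fun x => Real.abs_sin_le_one _)
  have hsin : ∀ t, ∫ x, Real.sin (t * ⟪ξ, x⟫) * ⟪ξ, x⟫ ∂μ = U * (A t * m t) := fun t => by
    rw [hS _ _ 1 (lipschitzWith_sin_mul_inner t ξ) (fun x => Real.abs_sin_le_one _)]
    congr 1
    have i1 := (hsi t).mul_prod (integrable_cos_sub_one_mul_inner hd hα t ξ)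
    have i2 := (hci t).mul_prod (integrable_sin_mul_inner hd hα t ξ)
    have e1 := integral_add i1 i2
    have p1 := integral_prod_mul (μ := μ) (ν := stableLevy d α) (fun x => Real.sin (t * ⟪ξ, x⟫))
      (fun u => (Real.cos (t * ⟪ξ, u⟫) - 1) * ⟪ξ, u⟫)
    have p2 := integral_prod_mul (μ := μ) (ν := stableLevy d α) (fun x => Real.cos (t * ⟪ξ, x⟫))
      (fun u => Real.sin (t * ⟪ξ, u⟫) * ⟪ξ, u⟫)
    rw [integral_cos_sub_one_mul_inner, mul_zero] at p1
    rw [p1, p2, zero_add] at e1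
    refine Eq.trans ?_ e1
    congr 1; ext z
    rw [inner_add_right, mul_add, Real.sin_add]; ring
  have hcos : ∀ t, ∫ x, Real.cos (t * ⟪ξ, x⟫) * ⟪ξ, x⟫ ∂μ = -(U * (B t * m t)) := fun t => by
    rw [hS _ _ 1 (lipschitzWith_cos_mul_inner t ξ) (fun x => Real.abs_cos_le_one _), ← mul_neg]
    congr 1
    have i1 := (hci t).mul_prod (integrable_cos_sub_one_mul_inner hd hα t ξ)
    have i2 := (hsi t).mul_prod (integrable_sin_mul_inner hd hα t ξ)
    have e1 := integral_sub i1 i2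
    have p1 := integral_prod_mul (μ := μ) (ν := stableLevy d α) (fun x => Real.cos (t * ⟪ξ, x⟫))
      (fun u => (Real.cos (t * ⟪ξ, u⟫) - 1) * ⟪ξ, u⟫)
    have p2 := integral_prod_mul (μ := μ) (ν := stableLevy d α) (fun x => Real.sin (t * ⟪ξ, x⟫))
      (fun u => Real.sin (t * ⟪ξ, u⟫) * ⟪ξ, u⟫)
    rw [integral_cos_sub_one_mul_inner, mul_zero] at p1
    rw [p1, p2, zero_sub] at e1
    refine Eq.trans ?_ e1
    congr 1; ext z
    rw [inner_add_right, mul_add, Real.cos_add]; ring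
  have hΨ := fun t => hasDerivAt_integral_one_sub_cos hd hα ξ t
  have hA1 := eq_mul_exp_neg_of_hasDerivAt (A := A) (U := U)
    (fun t => hsin t ▸ hasDerivAt_integral_cos_mul_inner hint ξ t) hΨ (by simp) 1
  have hB1 := eq_mul_exp_neg_of_hasDerivAt (A := B) (U := U)
    (fun t => hcos t ▸ hasDerivAt_integral_sin_mul_inner hint ξ t) hΨ (by simp) 1
  have hA0 : A 0 = 1 := by simp [hA]
  have hB0 : B 0 = 0 := by simp [hB]
  have hval := integral_one_sub_cos_stableLevy (d := d) hα ξ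
  simp only [hA0, hB0, one_mul, zero_mul, hval] at hA1 hB1
  have hexp : ∀ x : EuclideanSpace ℝ (Fin d), Complex.exp (Complex.I * (⟪ξ, x⟫ : ℂ)) =
      ((Real.cos (1 * ⟪ξ, x⟫) : ℝ) : ℂ) + ((Real.sin (1 * ⟪ξ, x⟫) : ℝ) : ℂ) * Complex.I := by
    intro x
    rw [mul_comm, Complex.exp_mul_I, one_mul, Complex.ofReal_cos, Complex.ofReal_sin]
  rw [charFn]
  simp only [hexp]
  rw [integral_add (hci 1).ofReal ((hsi 1).ofReal.mul_const _), integral_mul_const,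
    integral_complex_ofReal, integral_complex_ofReal]
  change ((A 1 : ℝ) : ℂ) + ((B 1 : ℝ) : ℂ) * Complex.I = _
  rw [hA1, hB1]
  push_cast
  simp

end CharacteristicFunction

lemma charFn_eq_charFun {d : ℕ} (μ : Measure (EuclideanSpace ℝ (Fin d)))
    (ξ : EuclideanSpace ℝ (Fin d)) : charFn μ ξ = charFun μ ξ := by
  rw [charFn, charFun_apply]
  congr 1; ext x
  rw [real_inner_comm, mul_comm]

lemma integrable_id_of_lintegral_rpow {d : ℕ} {μ : Measure (EuclideanSpace ℝ (Fin d))}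
    [IsProbabilityMeasure μ] {β : ℝ} (hβ : 1 < β)
    (h : ∫⁻ x, ENNReal.ofReal (‖x‖ ^ β) ∂μ < ⊤) : Integrable (fun x => x) μ := by
  have h1 : Integrable (fun x : EuclideanSpace ℝ (Fin d) => ‖x‖ ^ β) μ := by
    refine ⟨(measurable_norm.pow_const β).aestronglyMeasurable, ?_⟩
    rw [hasFiniteIntegral_iff_ofReal (Eventually.of_forall fun x => by positivity)]
    exact h
  refine ((integrable_const (1 : ℝ)).add h1).mono' (by fun_prop) (Eventually.of_forall fun x => ?_)
  simp only [Pi.add_apply]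
  rcases le_total ‖x‖ 1 with hx | hx
  · linarith [Real.rpow_nonneg (norm_nonneg x) β]
  · have := Real.rpow_le_rpow_of_exponent_le hx hβ.le
    rw [Real.rpow_one] at this
    linarith

lemma one_eighth_le_levy_moments {d : ℕ} (hd : 0 < d) {α : ℝ} (hα : α ∈ Ioo (1 : ℝ) 2) :
    1 / 8 ≤ (∫ u in {u : EuclideanSpace ℝ (Fin d) | ‖u‖ ≤ 1}, ‖u‖ ^ 2 ∂(stableLevy d α)) +
      ∫ u in {u : EuclideanSpace ℝ (Fin d) | 1 ≤ ‖u‖}, ‖u‖ ∂(stableLevy d α) := by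
  set ν := stableLevy d α
  set w : EuclideanSpace ℝ (Fin d) → ℝ := fun u => min (‖u‖ ^ 2) ‖u‖
  have hw : Integrable w ν := integrable_min_stableLevy hd hα
  have m1 : MeasurableSet {u : EuclideanSpace ℝ (Fin d) | ‖u‖ ≤ 1} :=
    measurableSet_le measurable_norm measurable_const
  have m2 : MeasurableSet {u : EuclideanSpace ℝ (Fin d) | 1 ≤ ‖u‖} :=
    measurableSet_le measurable_const measurable_norm
  have e1 : ∫ u in {u : EuclideanSpace ℝ (Fin d) | ‖u‖ ≤ 1}, ‖u‖ ^ 2 ∂ν =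
      ∫ u in {u : EuclideanSpace ℝ (Fin d) | ‖u‖ ≤ 1}, w u ∂ν :=
    setIntegral_congr_fun m1 fun u (hu : ‖u‖ ≤ 1) =>
      (min_eq_left (by nlinarith [norm_nonneg u])).symm
  have e2 : ∫ u in {u : EuclideanSpace ℝ (Fin d) | 1 ≤ ‖u‖}, ‖u‖ ∂ν =
      ∫ u in {u : EuclideanSpace ℝ (Fin d) | 1 ≤ ‖u‖}, w u ∂ν :=
    setIntegral_congr_fun m2 fun u (hu : 1 ≤ ‖u‖) => (min_eq_right (by nlinarith)).symm
  have hsub : {u : EuclideanSpace ℝ (Fin d) | ‖u‖ ≤ 1}ᶜ ⊆ {u | 1 ≤ ‖u‖} :=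
    fun u (hu : ¬ ‖u‖ ≤ 1) => (not_le.1 hu).le
  have hw0 : ∀ u, 0 ≤ w u := fun u => by positivity
  have hge : ∫ u, w u ∂ν ≤ (∫ u in {u : EuclideanSpace ℝ (Fin d) | ‖u‖ ≤ 1}, w u ∂ν) +
      ∫ u in {u : EuclideanSpace ℝ (Fin d) | 1 ≤ ‖u‖}, w u ∂ν := by
    rw [← integral_add_compl m1 hw]
    have := setIntegral_mono_set hw.integrableOn
      (ae_restrict_of_ae (Eventually.of_forall hw0)) hsub.eventuallyLE
    linarith
  have hξ := integral_one_sub_cos_stableLevy (d := d) hα (EuclideanSpace.single ⟨0, hd⟩ 1)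
  have hle := integral_mono (integrable_one_sub_cos_stableLevy hd hα _)
    (hw.const_mul _) (one_sub_cos_inner_le (EuclideanSpace.single ⟨0, hd⟩ 1))
  rw [hξ, integral_const_mul] at hle
  rw [e1, e2]
  norm_num at hle
  linarith

lemma abs_rpow_inv_sub_one_le {U α : ℝ} (hU : 0 < U) (hα : 1 < α) :
    |U ^ α⁻¹ - 1| ≤ |U - 1| := by
  have hα0 : 0 ≤ α⁻¹ := by positivity
  have hα1 : α⁻¹ ≤ 1 := inv_le_one_of_one_le₀ hα.le
  rcases le_total 1 U with h | h
  · have h1 := Real.one_le_rpow h hα0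
    have h2 := Real.rpow_le_rpow_of_exponent_le h hα1
    rw [Real.rpow_one] at h2
    rw [abs_of_nonneg (by linarith), abs_of_nonneg (by linarith)]
    linarith
  · have h1 := Real.rpow_le_one hU.le h hα0
    have h2 := Real.rpow_le_rpow_of_exponent_ge hU h hα1
    rw [Real.rpow_one] at h2
    rw [abs_of_nonpos (by linarith), abs_of_nonpos (by linarith)]
    linarith

lemma dW1_map_smul_le {d : ℕ} {μ : Measure (EuclideanSpace ℝ (Fin d))}
    [IsProbabilityMeasure μ] (hint : Integrable (fun x => x) μ) (c : ℝ) :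
    dW1 (μ.map fun x => c • x) μ ≤ |c - 1| * ∫ x, ‖x‖ ∂μ := by
  refine csSup_le ⟨0, fun _ => 0, contDiff_const, by simp, by simp, by simp⟩ ?_
  rintro r ⟨h, hh, hb, hd, rfl⟩
  have hc := hh.continuous
  have hlip : LipschitzWith 1 h :=
    lipschitzWith_of_nnnorm_fderiv_le (𝕜 := ℝ) (hh.differentiable one_ne_zero) hd
  have i1 : Integrable (fun x => h (c • x)) μ :=
    Integrable.of_bound (Continuous.aestronglyMeasurable (by fun_prop)) 1
      (Eventually.of_forall fun x => hb _)
  have i2 : Integrable h μ := integrable_of_lipschitz_bounded hlip hb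
  rw [integral_map (by fun_prop) hc.aestronglyMeasurable, ← integral_sub i1 i2,
    ← integral_const_mul]
  refine norm_integral_le_of_norm_le (G := ℝ) (f := fun x => h (c • x) - h x)
    (hint.norm.const_mul _) (Eventually.of_forall fun x => ?_)
  have := hlip.dist_le_mul (c • x) x
  rw [NNReal.coe_one, one_mul, dist_eq_norm, dist_eq_norm] at this
  calc _ ≤ ‖c • x - x‖ := this
    _ = ‖(c - 1) • x‖ := by rw [sub_smul, one_smul]
    _ = _ := by rw [norm_smul, Real.norm_eq_abs]

/-- Measures with the characteristic function of a rescaled stable law are rescaled stable laws. -/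
lemma eq_map_smul_of_charFn {d : ℕ} {α U : ℝ} (hα : 0 < α) (hU : 0 < U)
    {μ μα : Measure (EuclideanSpace ℝ (Fin d))} [IsProbabilityMeasure μ] [IsProbabilityMeasure μα]
    (hchar : ∀ ξ, charFn μα ξ = Complex.exp (-((‖ξ‖ ^ α / 2 : ℝ) : ℂ)))
    (hμ : ∀ ξ, charFn μ ξ = Complex.exp (-((U * (‖ξ‖ ^ α / 2) : ℝ) : ℂ))) :
    μ = μα.map fun x => U ^ α⁻¹ • x := by
  have : IsProbabilityMeasure (μα.map fun x => U ^ α⁻¹ • x) :=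
    Measure.isProbabilityMeasure_map (by fun_prop)
  refine Measure.ext_of_charFun (funext fun ξ => ?_)
  rw [charFun_map_smul, ← charFn_eq_charFun, ← charFn_eq_charFun, hμ, hchar, norm_smul,
    Real.norm_of_nonneg (by positivity), Real.mul_rpow (by positivity) (by positivity),
    ← Real.rpow_mul hU.le, inv_mul_cancel₀ hα.ne', Real.rpow_one, mul_div_assoc]

/-- Stability of the Poincaré-ratio functional for the rotationally invariant `α`-stable
laws, `α ∈ (1,2)` (`thm:stability`). -/
theorem stmt16 (d : ℕ) (hd : 0 < d) (α : ℝ) (hα : α ∈ Ioo (1 : ℝ) 2)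
    (μα : Measure (EuclideanSpace ℝ (Fin d))) [IsProbabilityMeasure μα]
    (hchar : ∀ ξ, charFn μα ξ = Complex.exp (-((‖ξ‖ ^ α / 2 : ℝ) : ℂ))) :
    ∃ C : ℝ, 0 < C ∧
      ∀ β : ℝ, β ∈ Ioo 1 α →
      ∀ μ : Measure (EuclideanSpace ℝ (Fin d)), IsProbabilityMeasure μ →
        (∫ x, x ∂μ) = 0 →
        (∫⁻ x, ENNReal.ofReal (‖x‖ ^ β) ∂μ < ⊤) →
        (∀ s : Set (EuclideanSpace ℝ (Fin d)), MeasurableSet s → μ s = 0 →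
          ∫⁻ x, stableLevy d α ((fun u => x + u) ⁻¹' s) ∂μ = 0) →
        ∀ U : ℝ, 0 < U →
        (∀ f : EuclideanSpace ℝ (Fin d) → ℝ,
          (∃ K : ℝ≥0, LipschitzWith K f) → (∃ M : ℝ, ∀ x, |f x| ≤ M) →
          (∫ x, f x ∂μ) = 0 →
          ∫ x, (f x) ^ 2 ∂μ ≤ U * Eform (stableLevy d α) μ f f) →
        (∀ j : Fin d,
          Tendsto (fun R : ℝ =>
              U * Eform (stableLevy d α) μ (gTruncC μ R j) (gTruncC μ R j)
                - ∫ x, (gTruncC μ R j x) ^ 2 ∂μ)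
            atTop (𝓝 0)) →
        dW1 μ μα
          ≤ C * ((∫ u in {u : EuclideanSpace ℝ (Fin d) | ‖u‖ ≤ 1}, ‖u‖ ^ 2 ∂(stableLevy d α))
              + ∫ u in {u : EuclideanSpace ℝ (Fin d) | 1 ≤ ‖u‖}, ‖u‖ ∂(stableLevy d α))
            * |U - 1| := by
  refine ⟨8 * (∫ x, ‖x‖ ∂μα + 1), by positivity, ?_⟩
  intro β hβ μ hμ hcent hmom _ U hU hP hlim
  have hint := integrable_id_of_lintegral_rpow hβ.1 hmom
  have hcharμ := fun ξ => charFn_eq_of_stein hd hα hint ξ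
    fun f L M hf hM => stein_identity hd hα hint hcent hP hlim hf hM ξ
  have hα0 : 0 < α := by linarith [hα.1]
  have heq := eq_map_smul_of_charFn hα0 hU hchar hcharμ
  have hc : 0 < U ^ α⁻¹ := by positivity
  have hintα : Integrable (fun x => x) μα := by
    have h1 := hint
    rw [heq, integrable_map_measure (by fun_prop) (by fun_prop)] at h1
    refine (h1.smul (U ^ α⁻¹)⁻¹).congr (Eventually.of_forall fun x => ?_)
    simp [smul_smul, inv_mul_cancel₀ hc.ne']
  have hm : 0 ≤ ∫ x, ‖x‖ ∂μα := integral_nonneg fun x => norm_nonneg x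
  have hK := one_eighth_le_levy_moments hd hα
  calc dW1 μ μα ≤ |U ^ α⁻¹ - 1| * ∫ x, ‖x‖ ∂μα := by
        conv_lhs => rw [heq]
        exact dW1_map_smul_le hintα _
    _ ≤ |U - 1| * (∫ x, ‖x‖ ∂μα + 1) :=
        mul_le_mul (abs_rpow_inv_sub_one_le hU hα.1) (by linarith) hm (abs_nonneg _)
    _ = 8 * (∫ x, ‖x‖ ∂μα + 1) * (1 / 8) * |U - 1| := by ring
    _ ≤ _ := by gcongr
end
end

section
/- Let ν be a Lévy measure on ℝ^d with polar decomposition ν(du) = 1_{(0,∞)}(r) 1_{S^{d−1}}(x)(k_x(r)/r) dr σ(dx), where σ is a finite positive measure on S^{d−1} and k_x(r) ≥ 0 is nonincreasing and continuous in r ∈ (0,∞), continuous in x ∈ S^{d−1}, with lim_{r→0⁺} r²k_x(r) = 0 and lim_{r→∞} k_x(r) = 0 for every x. For t ≥ 0 and ξ ∈ ℝ^d let ψ_t(ξ) = exp( ∫_{(0,∞)×S^{d−1}} (e^{ir⟨x,ξ⟩} − 1 − i⟨rx,ξ⟩1_{r≤1}) (k_x(r)/r) dr σ(dx) − ∫_{(0,∞)×S^{d−1}}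 (e^{ir⟨x,ξ⟩} − 1 − i⟨rx,ξ⟩1_{r≤e^{−t}}) (k_x(e^t r)/r) dr σ(dx) ). Then for every fixed ξ ∈ ℝ^d, the function t ↦ ψ_t(ξ) is continuously differentiable on [0,∞) and, for all t ≥ 0, d/dt ψ_t(ξ) = ( −i e^{−t} ⟨∫_{S^{d−1}} k_x(1) x σ(dx), ξ⟩ + ∫_{ℝ^d} (e^{i⟨u, ξe^{−t}⟩} − 1 − i⟨u, ξe^{−t}⟩1_{‖u‖≤1}) ν̃(du) ) ψ_t(ξ), where ν̃(du) = 1_{(0,∞)}(r)1_{S^{d−1}}(x)(−dk_x(r)) σ(dx). -/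
open MeasureTheory ProbabilityTheory Filter Set
open scoped RealInnerProductSpace ENNReal NNReal Topology

noncomputable section

/-- A Lévy measure on `ℝ^d`. -/
def IsLevyMeasure {d : ℕ} (ν : Measure (EuclideanSpace ℝ (Fin d))) : Prop :=
  ν {0} = 0 ∧ ∫⁻ u, ENNReal.ofReal (min 1 (‖u‖ ^ 2)) ∂ν < ⊤

/-- The function `ψ_t(ξ)` of Lemma A.1 (`lem:diffallpoints`). -/
def psiFn {d : ℕ} (σ : Measure (EuclideanSpace ℝ (Fin d)))
    (k : EuclideanSpace ℝ (Fin d) → ℝ → ℝ) (t : ℝ) (ξ : EuclideanSpace ℝ (Fin d)) : ℂ :=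
  Complex.exp
    ((∫ x, (∫ r in Ioi (0 : ℝ),
        (Complex.exp (Complex.I * ((r * ⟪x, ξ⟫ : ℝ) : ℂ)) - 1
          - (if r ≤ 1 then Complex.I * ((r * ⟪x, ξ⟫ : ℝ) : ℂ) else 0))
          * ((k x r / r : ℝ) : ℂ)) ∂σ)
      - ∫ x, (∫ r in Ioi (0 : ℝ),
        (Complex.exp (Complex.I * ((r * ⟪x, ξ⟫ : ℝ) : ℂ)) - 1
          - (if r ≤ Real.exp (-t) then Complex.I * ((r * ⟪x, ξ⟫ : ℝ) : ℂ) else 0))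
          * ((k x (Real.exp t * r) / r : ℝ) : ℂ)) ∂σ)

/-- The Lévy–Khintchine integrand `e^{irb} - 1 - irb 1_{r ≤ 1}`. -/
def compExp (b r : ℝ) : ℂ :=
  Complex.exp (Complex.I * ((r * b : ℝ) : ℂ)) - 1
    - (if r ≤ 1 then Complex.I * ((r * b : ℝ) : ℂ) else 0)

/-- The integrand compensated by `i b min(s, 1)`. -/
def compExpMin (b s : ℝ) : ℂ :=
  Complex.exp (Complex.I * ((s * b : ℝ) : ℂ)) - 1 - Complex.I * ((min s 1 * b : ℝ) : ℂ)

/-- The primitive `s ↦ ∫₀ˢ compExp b r / r dr`. -/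
def compExpPrim (b s : ℝ) : ℂ :=
  ∫ r in Ioi (0 : ℝ), if r < s then compExp b r * ((1 / r : ℝ) : ℂ) else 0

/-- The primitive `s ↦ ∫₀ˢ min(1, r²) / r dr`. -/
def levyWeight (s : ℝ) : ℝ≥0∞ :=
  ∫⁻ r in Ioi (0 : ℝ), if r < s then ENNReal.ofReal (min 1 (r ^ 2) / r) else 0

lemma norm_exp_I_mul_sub_one_sub_le (y : ℝ) :
    ‖Complex.exp (Complex.I * (y : ℂ)) - 1 - Complex.I * (y : ℂ)‖ ≤ 2 * y ^ 2 := by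
  have hn : ‖Complex.I * (y : ℂ)‖ = |y| := by simp
  rcases le_total |y| 1 with h | h
  · have := Complex.norm_exp_sub_one_sub_id_le (x := Complex.I * (y : ℂ)) (by rwa [hn])
    rw [hn, sq_abs] at this
    nlinarith [sq_nonneg y]
  · calc _ ≤ ‖Complex.exp (Complex.I * (y : ℂ)) - 1‖ + ‖Complex.I * (y : ℂ)‖ := norm_sub_le _ _
      _ ≤ |y| + |y| := add_le_add Real.norm_exp_I_mul_ofReal_sub_one_le hn.le
      _ ≤ 2 * y ^ 2 := by rw [← sq_abs]; nlinarith

lemma norm_exp_I_mul_sub_one_le_two (y : ℝ) :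
    ‖Complex.exp (Complex.I * (y : ℂ)) - 1‖ ≤ 2 := by
  refine (norm_sub_le _ _).trans ?_
  rw [mul_comm, Complex.norm_exp_ofReal_mul_I, norm_one]
  norm_num

lemma norm_compExp_le {b r B : ℝ} (hb : |b| ≤ B) (hr : 0 < r) :
    ‖compExp b r‖ ≤ (2 * B ^ 2 + 2) * min 1 (r ^ 2) := by
  have hB : b ^ 2 ≤ B ^ 2 := by rw [← sq_abs]; gcongr
  unfold compExp
  split_ifs with h
  · refine (norm_exp_I_mul_sub_one_sub_le _).trans ?_
    rw [min_eq_right (by nlinarith), mul_pow]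
    nlinarith [mul_le_mul_of_nonneg_left hB (sq_nonneg r), sq_nonneg r]
  · rw [sub_zero, min_eq_left (by nlinarith)]
    refine (norm_exp_I_mul_sub_one_le_two _).trans ?_
    nlinarith [sq_nonneg B]

lemma norm_compExpMin_le {b s B : ℝ} (hb : |b| ≤ B) (hs : 0 < s) :
    ‖compExpMin b s‖ ≤ (2 * B ^ 2 + B + 2) * min 1 (s ^ 2) := by
  have hB : b ^ 2 ≤ B ^ 2 := by rw [← sq_abs]; gcongr
  have hB0 : 0 ≤ B := (abs_nonneg b).trans hb
  unfold compExpMin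
  rcases le_or_gt s 1 with h | h
  · rw [min_eq_left h, min_eq_right (by nlinarith)]
    refine (norm_exp_I_mul_sub_one_sub_le _).trans ?_
    rw [mul_pow]
    nlinarith [mul_le_mul_of_nonneg_left hB (sq_nonneg s), sq_nonneg s,
      mul_nonneg hB0 (sq_nonneg s)]
  · rw [min_eq_right h.le, min_eq_left (by nlinarith)]
    refine (norm_sub_le _ _).trans ?_
    have h1 := norm_exp_I_mul_sub_one_le_two (s * b)
    have h2 : ‖Complex.I * ((1 * b : ℝ) : ℂ)‖ = |b| := by simp
    rw [h2]
    nlinarith [sq_nonneg B]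

lemma measurable_uncurry_compExp : Measurable fun p : ℝ × ℝ => compExp p.1 p.2 := by
  unfold compExp
  refine Measurable.sub (by fun_prop) ?_
  exact Measurable.ite (measurableSet_le (by fun_prop) (by fun_prop)) (by fun_prop) (by fun_prop)

lemma measurable_compExp (b : ℝ) : Measurable (compExp b) :=
  measurable_uncurry_compExp.comp (measurable_const.prodMk measurable_id)

lemma measurable_uncurry_compExpMin : Measurable fun p : ℝ × ℝ => compExpMin p.1 p.2 := by
  unfold compExpMin
  fun_prop

lemma measurable_uncurry_compExpPrim : Measurable fun p : ℝ × ℝ => compExpPrim p.1 p.2 := by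
  unfold compExpPrim
  refine StronglyMeasurable.measurable (StronglyMeasurable.integral_prod_right
    (f := fun (p : ℝ × ℝ) (r : ℝ) =>
      if r < p.2 then compExp p.1 r * ((1 / r : ℝ) : ℂ) else 0) ?_)
  refine Measurable.stronglyMeasurable ?_
  refine Measurable.ite (measurableSet_lt (by fun_prop) (by fun_prop)) ?_ (by fun_prop)
  exact (measurable_uncurry_compExp.comp
    (f := fun q : (ℝ × ℝ) × ℝ => (q.1.1, q.2)) (by fun_prop)).mul (by fun_prop)

lemma measurable_levyWeight : Measurable levyWeight := by
  unfold levyWeight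
  refine Measurable.lintegral_prod_right'
    (f := fun q : ℝ × ℝ => if q.2 < q.1 then ENNReal.ofReal (min 1 (q.2 ^ 2) / q.2) else 0) ?_
  exact Measurable.ite (measurableSet_lt (by fun_prop) (by fun_prop)) (by fun_prop) (by fun_prop)

lemma levyWeight_eq (s : ℝ) :
    levyWeight s = ∫⁻ r in Ioo 0 s, ENNReal.ofReal (min 1 (r ^ 2) / r) := by
  rw [levyWeight, ← Iio_inter_Ioi, ← Measure.restrict_restrict measurableSet_Iio,
    ← lintegral_indicator measurableSet_Iio]
  rfl

lemma compExpPrim_eq (b s : ℝ) :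
    compExpPrim b s = ∫ r in Ioo 0 s, compExp b r * ((1 / r : ℝ) : ℂ) := by
  rw [compExpPrim, ← Iio_inter_Ioi, ← Measure.restrict_restrict measurableSet_Iio,
    ← integral_indicator measurableSet_Iio]
  rfl

lemma ofReal_min_le_levyWeight {s : ℝ} (hs : 0 < s) :
    ENNReal.ofReal (min 1 (s ^ 2)) ≤ 4 * levyWeight s := by
  set m := min s 1 with hm
  have hm0 : 0 < m := lt_min hs one_pos
  have hms : m ≤ s := min_le_left _ _
  have hm1 : m ≤ 1 := min_le_right _ _
  have hsq : min 1 (s ^ 2) = m ^ 2 := by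
    rcases le_total s 1 with h | h
    · rw [hm, min_eq_left h, min_eq_right (by nlinarith)]
    · rw [hm, min_eq_right h, min_eq_left (by nlinarith)]; norm_num
  have key : ENNReal.ofReal (m / 2) * ENNReal.ofReal (m / 2) ≤ levyWeight s := by
    rw [levyWeight_eq]
    calc ENNReal.ofReal (m / 2) * ENNReal.ofReal (m / 2)
        = ∫⁻ r in Ioo (m / 2) m, ENNReal.ofReal (m / 2) := by
          rw [setLIntegral_const, Real.volume_Ioo]; congr 2; ring
      _ ≤ ∫⁻ r in Ioo (m / 2) m, ENNReal.ofReal (min 1 (r ^ 2) / r) := by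
          refine setLIntegral_mono' measurableSet_Ioo fun r hr => ENNReal.ofReal_le_ofReal ?_
          have hr0 : 0 < r := by linarith [hr.1]
          rw [min_eq_right (by nlinarith [hr.2]), le_div_iff₀ hr0]
          nlinarith [hr.1]
      _ ≤ _ := lintegral_mono_set (Ioo_subset_Ioo (by linarith) hms)
  calc ENNReal.ofReal (min 1 (s ^ 2))
      = 4 * (ENNReal.ofReal (m / 2) * ENNReal.ofReal (m / 2)) := by
        rw [hsq, ← ENNReal.ofReal_mul (by positivity),
          show (4 : ℝ≥0∞) = ENNReal.ofReal 4 by norm_num, ← ENNReal.ofReal_mul (by norm_num)]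
        congr 1; ring
    _ ≤ _ := by gcongr

lemma enorm_compExp_mul_inv_le {b r B : ℝ} (hb : |b| ≤ B) (hr : 0 < r) :
    ‖compExp b r * ((1 / r : ℝ) : ℂ)‖ₑ
      ≤ ENNReal.ofReal (2 * B ^ 2 + 2) * ENNReal.ofReal (min 1 (r ^ 2) / r) := by
  rw [← ENNReal.ofReal_mul (by positivity), ← ofReal_norm]
  refine ENNReal.ofReal_le_ofReal ?_
  rw [norm_mul, Complex.norm_real, Real.norm_of_nonneg (by positivity), ← mul_div_assoc, ← mul_div_assoc,
    mul_one]
  gcongr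
  exact norm_compExp_le hb hr

lemma enorm_compExpPrim_le {b s B : ℝ} (hb : |b| ≤ B) :
    ‖compExpPrim b s‖ₑ ≤ ENNReal.ofReal (2 * B ^ 2 + 2) * levyWeight s := by
  rw [compExpPrim_eq, levyWeight_eq, ← lintegral_const_mul' _ _ ENNReal.ofReal_ne_top]
  exact (enorm_integral_le_lintegral_enorm _).trans
    (setLIntegral_mono' measurableSet_Ioo fun r hr => enorm_compExp_mul_inv_le hb hr.1)

lemma integral_deriv_compExp {b s : ℝ} (hs : 0 < s) :
    ∫ r in Ioo 0 s, ((b : ℂ) * Complex.I * Complex.exp (Complex.I * ((r * b : ℝ) : ℂ))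
        - if r ≤ 1 then Complex.I * (b : ℂ) else 0) = compExpMin b s := by
  have h1 : ∫ r in Ioo 0 s, (b : ℂ) * Complex.I * Complex.exp (Complex.I * ((r * b : ℝ) : ℂ))
      = Complex.exp (Complex.I * ((s * b : ℝ) : ℂ)) - 1 := by
    rw [← integral_Ioc_eq_integral_Ioo, ← intervalIntegral.integral_of_le hs.le]
    rw [intervalIntegral.integral_eq_sub_of_hasDerivAt
      (f := fun r : ℝ => Complex.exp (Complex.I * ((r * b : ℝ) : ℂ)))]
    · simp
    · intro r _
      have : HasDerivAt (fun r : ℝ => Complex.I * ((r * b : ℝ) : ℂ)) (Complex.I * (b : ℂ)) r := by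
        have := ((hasDerivAt_id r).mul_const b).ofReal_comp.const_mul Complex.I
        simpa using this
      refine this.cexp.congr_deriv ?_
      ring
    · exact Continuous.intervalIntegrable (by fun_prop) _ _
  have h2 : ∫ r in Ioo 0 s, (if r ≤ 1 then Complex.I * (b : ℂ) else 0)
      = Complex.I * ((min s 1 * b : ℝ) : ℂ) := by
    have : (fun r : ℝ => if r ≤ 1 then Complex.I * (b : ℂ) else 0)
        = (Iic 1).indicator (fun _ => Complex.I * (b : ℂ)) := rfl
    rw [← integral_Ioc_eq_integral_Ioo, this, integral_indicator measurableSet_Iic,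
      Measure.restrict_restrict measurableSet_Iic, inter_comm, Ioc_inter_Iic, setIntegral_const]
    rw [Measure.real, Real.volume_Ioc, sub_zero, ENNReal.toReal_ofReal (by positivity)]
    rw [Complex.real_smul, inf_comm]; push_cast; ring
  rw [integral_sub, h1, h2, compExpMin]
  · exact (Continuous.integrableOn_Icc (by fun_prop)).mono_set Ioo_subset_Icc_self
  · refine Integrable.mono' (integrable_const |b|) ?_ (ae_of_all _ fun r => ?_)
    · exact (Measurable.ite measurableSet_Iic (by fun_prop) (by fun_prop)).aestronglyMeasurable
    · split_ifs <;> simp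

lemma hasDerivAt_compExpPrim (a : ℝ) {s : ℝ} (hs : 0 < s) (t : ℝ) :
    HasDerivAt (fun t => compExpPrim (Real.exp (-t) * a) s)
      (-compExpMin (Real.exp (-t) * a) s) t := by
  simp only [compExpPrim_eq]
  rw [← integral_deriv_compExp hs, ← integral_neg]
  set B : ℝ := Real.exp (1 - t) * |a| with hB
  have hbd : ∀ u ∈ Metric.ball t 1, |Real.exp (-u) * a| ≤ B := by
    intro u hu
    rw [Real.ball_eq_Ioo] at hu
    rw [abs_mul, abs_of_pos (Real.exp_pos _)]
    exact mul_le_mul_of_nonneg_right (Real.exp_le_exp.2 (by linarith [hu.1])) (abs_nonneg a)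
  have hmeas : ∀ u : ℝ, AEStronglyMeasurable
      (fun r : ℝ => compExp (Real.exp (-u) * a) r * ((1 / r : ℝ) : ℂ))
      (volume.restrict (Ioo 0 s)) := fun u =>
    ((measurable_compExp _).mul (by fun_prop)).aestronglyMeasurable
  refine (hasDerivAt_integral_of_dominated_loc_of_deriv_le (bound := fun _ => 2 * B)
    (F' := fun u r => -((↑(Real.exp (-u) * a) : ℂ) * Complex.I *
      Complex.exp (Complex.I * ((r * (Real.exp (-u) * a) : ℝ) : ℂ))
        - if r ≤ 1 then Complex.I * ((Real.exp (-u) * a : ℝ) : ℂ) else 0))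
    (Metric.ball_mem_nhds t one_pos) (Eventually.of_forall hmeas) ?_ ?_ ?_ ?_ ?_).2
  · refine Integrable.mono' (integrable_const (2 * B ^ 2 + 2) |>.mul_const s) (hmeas t) ?_
    refine (ae_restrict_mem measurableSet_Ioo).mono fun r hr => ?_
    have h1 := norm_compExp_le (hbd t (Metric.mem_ball_self one_pos)) hr.1
    rw [norm_mul, Complex.norm_real, Real.norm_of_nonneg (one_div_nonneg.2 hr.1.le),
      mul_one_div, div_le_iff₀ hr.1]
    refine h1.trans ?_
    rw [mul_assoc]
    gcongr
    refine (min_le_right _ _).trans ?_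
    nlinarith [hr.1, hr.2]
  · refine Measurable.aestronglyMeasurable (Measurable.neg (Measurable.sub (by fun_prop) ?_))
    exact Measurable.ite measurableSet_Iic (by fun_prop) (by fun_prop)
  · refine ae_of_all _ fun r u hu => ?_
    have h := hbd u hu
    set b := Real.exp (-u) * a
    rw [norm_neg]
    refine (norm_sub_le _ _).trans ?_
    have h1 : ‖(b : ℂ) * Complex.I * Complex.exp (Complex.I * ((r * b : ℝ) : ℂ))‖ = |b| := by
      rw [norm_mul, mul_comm Complex.I ((r * b : ℝ) : ℂ), Complex.norm_exp_ofReal_mul_I]; simp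
    have h2 : ‖(if r ≤ 1 then Complex.I * (b : ℂ) else 0)‖ ≤ |b| := by
      split_ifs <;> simp
    linarith
  · exact integrable_const _
  · refine (ae_restrict_mem measurableSet_Ioo).mono fun r hr u _ => ?_
    have hr0 : (r : ℂ) ≠ 0 := by exact_mod_cast hr.1.ne'
    have h0 : HasDerivAt (fun u : ℝ => Real.exp (-u) * a) (-(Real.exp (-u) * a)) u := by
      have := ((hasDerivAt_neg u).exp).mul_const a
      simpa using this
    have h1 : HasDerivAt (fun u : ℝ => Complex.I * ((r * (Real.exp (-u) * a) : ℝ) : ℂ))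
        (Complex.I * ((r * -(Real.exp (-u) * a) : ℝ) : ℂ)) u :=
      (h0.const_mul r).ofReal_comp.const_mul Complex.I
    unfold compExp
    split_ifs with hr1
    · refine (((h1.cexp.sub_const 1).sub h1).mul_const ((1 / r : ℝ) : ℂ)).congr_deriv ?_
      push_cast
      field_simp
      ring
    · refine (((h1.cexp.sub_const 1).sub_const 0).mul_const ((1 / r : ℝ) : ℂ)).congr_deriv ?_
      push_cast
      field_simp
      ring

section Family

variable {X : Type*} [MeasurableSpace X] {M : Measure X} {a s : X → ℝ} {A : ℝ}

lemma integrable_min_one_sq (hs : Measurable s) (hs0 : ∀ᵐ p ∂M, 0 < s p)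
    (hW : ∫⁻ p, levyWeight (s p) ∂M < ⊤) : Integrable (fun p => min 1 (s p ^ 2)) M := by
  refine ⟨Measurable.aestronglyMeasurable (by fun_prop), ?_⟩
  calc ∫⁻ p, ‖min 1 (s p ^ 2)‖ₑ ∂M ≤ ∫⁻ p, 4 * levyWeight (s p) ∂M := by
        refine lintegral_mono_ae (hs0.mono fun p hp => ?_)
        rw [Real.enorm_eq_ofReal (by positivity)]
        exact ofReal_min_le_levyWeight hp
    _ = 4 * ∫⁻ p, levyWeight (s p) ∂M := lintegral_const_mul' _ _ (by norm_num)
    _ < ⊤ := ENNReal.mul_lt_top (by norm_num) hW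

lemma integrable_compExpPrim (ha : Measurable a) (hs : Measurable s)
    (hA : ∀ᵐ p ∂M, |a p| ≤ A)
    (hW : ∫⁻ p, levyWeight (s p) ∂M < ⊤) : Integrable (fun p => compExpPrim (a p) (s p)) M := by
  refine ⟨(measurable_uncurry_compExpPrim.comp (ha.prodMk hs)).aestronglyMeasurable, ?_⟩
  refine (lintegral_mono_ae (hA.mono fun p hp => enorm_compExpPrim_le hp)).trans_lt ?_
  rw [lintegral_const_mul' _ _ ENNReal.ofReal_ne_top]
  exact ENNReal.mul_lt_top ENNReal.ofReal_lt_top hW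

lemma abs_exp_neg_mul_le {t u a A : ℝ} (hu : u ∈ Metric.ball t 1) (ha : |a| ≤ A) :
    |Real.exp (-u) * a| ≤ Real.exp (1 - t) * A := by
  rw [Real.ball_eq_Ioo] at hu
  rw [abs_mul, abs_of_pos (Real.exp_pos _)]
  gcongr
  linarith [hu.1]

lemma measurable_compExpMin_exp (ha : Measurable a) (hs : Measurable s) (t : ℝ) :
    Measurable fun p => compExpMin (Real.exp (-t) * a p) (s p) :=
  measurable_uncurry_compExpMin.comp ((ha.const_mul _).prodMk hs)

lemma hasDerivAt_integral_compExpPrim (ha : Measurable a) (hs : Measurable s)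
    (hA : ∀ᵐ p ∂M, |a p| ≤ A) (hs0 : ∀ᵐ p ∂M, 0 < s p)
    (hW : ∫⁻ p, levyWeight (s p) ∂M < ⊤) (t : ℝ) :
    Integrable (fun p => compExpMin (Real.exp (-t) * a p) (s p)) M ∧
    HasDerivAt (fun t => ∫ p, compExpPrim (Real.exp (-t) * a p) (s p) ∂M)
      (-∫ p, compExpMin (Real.exp (-t) * a p) (s p) ∂M) t := by
  rw [← integral_neg]
  have key := hasDerivAt_integral_of_dominated_loc_of_deriv_le
    (μ := M) (x₀ := t) (F := fun t p => compExpPrim (Real.exp (-t) * a p) (s p))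
    (F' := fun t p => -compExpMin (Real.exp (-t) * a p) (s p))
    (bound := fun p => (2 * (Real.exp (1 - t) * A) ^ 2 + Real.exp (1 - t) * A + 2)
      * min 1 (s p ^ 2))
    (Metric.ball_mem_nhds t one_pos)
    (Eventually.of_forall fun u => (measurable_uncurry_compExpPrim.comp
      ((ha.const_mul _).prodMk hs)).aestronglyMeasurable)
    (integrable_compExpPrim (ha.const_mul _) hs
      (hA.mono fun p hp => abs_exp_neg_mul_le (Metric.mem_ball_self one_pos) hp) hW)
    (measurable_compExpMin_exp ha hs t).neg.aestronglyMeasurable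
    ?_ ((integrable_min_one_sq hs hs0 hW).const_mul _)
    (hs0.mono fun p hp u _ => hasDerivAt_compExpPrim _ hp u)
  · exact ⟨by simpa using key.1.neg, key.2⟩
  · filter_upwards [hA, hs0] with p hp hp0 u hu
    rw [norm_neg]
    exact norm_compExpMin_le (abs_exp_neg_mul_le hu hp) hp0

lemma continuous_integral_compExpMin (ha : Measurable a) (hs : Measurable s)
    (hA : ∀ᵐ p ∂M, |a p| ≤ A) (hs0 : ∀ᵐ p ∂M, 0 < s p)
    (hW : ∫⁻ p, levyWeight (s p) ∂M < ⊤) :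
    Continuous fun t => ∫ p, compExpMin (Real.exp (-t) * a p) (s p) ∂M := by
  refine continuous_iff_continuousAt.2 fun t => continuousAt_of_dominated
    (bound := fun p => (2 * (Real.exp (1 - t) * A) ^ 2 + Real.exp (1 - t) * A + 2)
      * min 1 (s p ^ 2))
    (Eventually.of_forall fun u => (measurable_compExpMin_exp ha hs u).aestronglyMeasurable)
    ?_ ((integrable_min_one_sq hs hs0 hW).const_mul _) (ae_of_all _ fun p => ?_)
  · filter_upwards [Metric.ball_mem_nhds t one_pos] with u hu
    filter_upwards [hA, hs0] with p hp hp0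
    exact norm_compExpMin_le (abs_exp_neg_mul_le hu hp) hp0
  · unfold compExpMin
    fun_prop

end Family

section Tail

variable {μ : Measure ℝ} {k : ℝ → ℝ}

lemma lintegral_levyWeight_eq [SFinite μ] (hk : ∀ r, 0 < r → μ (Ioi r) = ENNReal.ofReal (k r)) :
    ∫⁻ s, levyWeight s ∂μ
      = ∫⁻ r in Ioi (0 : ℝ), ENNReal.ofReal (min 1 (r ^ 2)) * ENNReal.ofReal (k r / r) := by
  unfold levyWeight
  rw [lintegral_lintegral_swap]
  · refine setLIntegral_congr_fun measurableSet_Ioi fun r hr => ?_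
    have hr0 : (0 : ℝ) < r := hr
    have : (fun s : ℝ => if r < s then ENNReal.ofReal (min 1 (r ^ 2) / r) else 0)
        = (Ioi r).indicator (fun _ => ENNReal.ofReal (min 1 (r ^ 2) / r)) := rfl
    simp only [this]
    rw [lintegral_indicator measurableSet_Ioi, setLIntegral_const, hk r hr0,
      ENNReal.ofReal_div_of_pos hr0, ENNReal.ofReal_div_of_pos hr0]
    simp only [div_eq_mul_inv]
    ring
  · refine Measurable.aemeasurable ?_
    exact Measurable.ite (measurableSet_lt (by fun_prop) (by fun_prop)) (by fun_prop)
      (by fun_prop)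

lemma integral_compExp_mul_div_eq [SFinite μ] (hk0 : ∀ r, 0 < r → 0 ≤ k r)
    (hk : ∀ r, 0 < r → μ (Ioi r) = ENNReal.ofReal (k r))
    (hW : ∫⁻ s, levyWeight s ∂μ < ⊤) (b : ℝ) :
    ∫ r in Ioi (0 : ℝ), compExp b r * ((k r / r : ℝ) : ℂ) = ∫ s, compExpPrim b s ∂μ := by
  unfold compExpPrim
  have hmeas : Measurable (Function.uncurry fun (s r : ℝ) =>
      if r < s then compExp b r * ((1 / r : ℝ) : ℂ) else 0) :=
    Measurable.ite (measurableSet_lt (by fun_prop) (by fun_prop))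
      (((measurable_compExp b).comp measurable_snd).mul (by fun_prop)) (by fun_prop)
  rw [integral_integral_swap]
  · refine setIntegral_congr_fun measurableSet_Ioi fun r hr => ?_
    have hr0 : (0 : ℝ) < r := hr
    have : (fun s : ℝ => if r < s then compExp b r * ((1 / r : ℝ) : ℂ) else 0)
        = (Ioi r).indicator (fun _ => compExp b r * ((1 / r : ℝ) : ℂ)) := rfl
    simp only [this]
    rw [integral_indicator measurableSet_Ioi, setIntegral_const, Measure.real, hk r hr0,
      ENNReal.toReal_ofReal (hk0 r hr0), Complex.real_smul]
    push_cast
    ring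
  · refine ⟨hmeas.aestronglyMeasurable, ?_⟩
    rw [HasFiniteIntegral, lintegral_prod _ hmeas.enorm.aemeasurable]
    calc _ ≤ ∫⁻ s, ENNReal.ofReal (2 * |b| ^ 2 + 2) * levyWeight s ∂μ := by
          refine lintegral_mono fun s => ?_
          rw [levyWeight, ← lintegral_const_mul' _ _ ENNReal.ofReal_ne_top]
          refine setLIntegral_mono' measurableSet_Ioi fun r hr => ?_
          simp only [Function.uncurry_apply_pair]
          split_ifs
          · exact enorm_compExp_mul_inv_le le_rfl hr
          · simp
      _ < ⊤ := by
          rw [lintegral_const_mul' _ _ ENNReal.ofReal_ne_top]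
          exact ENNReal.mul_lt_top ENNReal.ofReal_lt_top hW

lemma measure_Ioi_eq_of_tendsto {r : ℝ}
    (hμ : ∀ c, r ≤ c → μ (Ioc r c) = ENNReal.ofReal (k r - k c))
    (hk : Tendsto k atTop (𝓝 0)) : μ (Ioi r) = ENNReal.ofReal (k r) := by
  have hmono : Monotone fun c : ℝ => Ioc r c := fun _ _ h => Ioc_subset_Ioc_right h
  have h1 := tendsto_measure_iUnion_atTop (μ := μ) hmono
  rw [iUnion_Ioc_right] at h1
  refine tendsto_nhds_unique h1 ?_
  have h2 : Tendsto (fun c => ENNReal.ofReal (k r - k c)) atTop (𝓝 (ENNReal.ofReal (k r))) := by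
    simpa using ENNReal.tendsto_ofReal (hk.const_sub (k r))
  refine h2.congr' ?_
  filter_upwards [eventually_ge_atTop r] with c hc
  exact (hμ c hc).symm

end Tail

section KernelConstruction

variable {E : Type*} [TopologicalSpace E] [MeasurableSpace E] [OpensMeasurableSpace E]
  {S : Set E} {τ : E → Measure ℝ} {k : E → ℝ → ℝ}

open Classical in
lemma exists_isFiniteKernel_restrict_Ioc (hS : IsCompact S) (hSm : MeasurableSet S)
    (hkc : ∀ r : ℝ, 0 < r → ContinuousOn (fun x => k x r) S)
    (hτ : ∀ x, ∀ a c : ℝ, 0 < a → a ≤ c → τ x (Ioc a c) = ENNReal.ofReal (k x a - k x c))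
    {a c : ℝ} (ha : 0 < a) (hac : a ≤ c) :
    ∃ κ : Kernel E ℝ, IsFiniteKernel κ ∧ ∀ x ∈ S, κ x = (τ x).restrict (Ioc a c) := by
  have hval : ∀ c : ℝ, a ≤ c → ContinuousOn (fun x => τ x (Ioc a c)) S := fun c hac => by
    simp only [hτ _ a c ha hac]
    exact ENNReal.continuous_ofReal.comp_continuousOn
      ((hkc a ha).sub (hkc c (ha.trans_le hac)))
  set f : E → Measure ℝ := S.piecewise (fun x => (τ x).restrict (Ioc a c)) 0 with hf
  have happ : ∀ B, MeasurableSet B →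
      (fun x => f x B) = S.piecewise (fun x => τ x (B ∩ Ioc a c)) 0 := fun B hB => by
    ext x
    by_cases hx : x ∈ S <;> simp [hf, hx, Measure.restrict_apply hB]
  obtain ⟨C, hC⟩ := hS.exists_bound_of_continuousOn ((hkc a ha).sub (hkc c (ha.trans_le hac)))
  have hbound : ∀ x, f x univ ≤ ENNReal.ofReal C := fun x => by
    by_cases hx : x ∈ S
    · simp only [hf, hx, piecewise_eq_of_mem, Measure.restrict_apply_univ, hτ x a c ha hac]
      exact ENNReal.ofReal_le_ofReal ((le_abs_self _).trans (hC x hx))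
    · simp [hf, hx]
  have hfin : ∀ x, IsFiniteMeasure (f x) := fun x =>
    ⟨(hbound x).trans_lt ENNReal.ofReal_lt_top⟩
  have hmeas : Measurable f := by
    refine Measurable.measure_of_isPiSystem
      (BorelSpace.measurable_eq.trans (borel_eq_generateFrom_Iic ℝ)) isPiSystem_Iic ?_ ?_
    · rintro _ ⟨b, rfl⟩
      rw [happ _ measurableSet_Iic]
      refine ContinuousOn.measurable_piecewise ?_ continuousOn_const hSm
      rw [inter_comm]
      simp only [Ioc_inter_Iic]
      rcases le_total a (min c b) with h | h
      · exact hval _ h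
      · simp only [Ioc_eq_empty (not_lt.2 h), measure_empty]
        exact continuousOn_const
    · rw [happ _ MeasurableSet.univ]
      simp only [univ_inter]
      exact ContinuousOn.measurable_piecewise (hval c hac) continuousOn_const hSm
  refine ⟨⟨f, hmeas⟩, ⟨ENNReal.ofReal C, ENNReal.ofReal_lt_top, hbound⟩, fun x hx => ?_⟩
  change f x = _
  simp [hf, hx]

lemma exists_isSFiniteKernel_eq (hS : IsCompact S) (hSm : MeasurableSet S)
    (hkc : ∀ r : ℝ, 0 < r → ContinuousOn (fun x => k x r) S)
    (hτ : ∀ x, ∀ a c : ℝ, 0 < a → a ≤ c → τ x (Ioc a c) = ENNReal.ofReal (k x a - k x c))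
    (hτ0 : ∀ x, τ x (Iic 0) = 0) :
    ∃ κ : Kernel E ℝ, IsSFiniteKernel κ ∧ ∀ x ∈ S, κ x = τ x := by
  have hpow : Monotone fun n : ℤ => (2 : ℝ) ^ n := zpow_right_mono₀ one_le_two
  choose κ hκ hκS using fun n : ℤ => exists_isFiniteKernel_restrict_Ioc hS hSm hkc hτ
    (a := (2 : ℝ) ^ n) (c := (2 : ℝ) ^ (n + 1)) (by positivity) (hpow (by omega))
  refine ⟨Kernel.sum κ, Kernel.isSFiniteKernel_sum, fun x hx => ?_⟩
  have hunion : ⋃ n : ℤ, Ioc ((2 : ℝ) ^ n) ((2 : ℝ) ^ (n + 1)) = Ioi 0 := by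
    ext r
    simp only [mem_iUnion, mem_Ioi]
    exact ⟨fun ⟨n, hn⟩ => lt_trans (by positivity) hn.1,
      fun hr => exists_mem_Ioc_zpow hr one_lt_two⟩
  rw [Kernel.sum_apply]
  simp only [hκS _ x hx]
  have hdisj : Pairwise (Function.onFun Disjoint
      fun n : ℤ => Ioc ((2 : ℝ) ^ n) ((2 : ℝ) ^ (n + 1))) := hpow.pairwise_disjoint_on_Ioc_succ
  rw [← Measure.restrict_iUnion hdisj (fun _ => measurableSet_Ioc), hunion]
  refine Measure.restrict_eq_self_of_ae_mem ?_
  rw [ae_iff]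
  simpa [← Iic_def] using hτ0 x

end KernelConstruction

/-- `t ↦ ψ_t(ξ)` is continuously differentiable on `[0,∞)`, with explicit derivative
(`lem:diffallpoints`). -/
theorem stmt17 {d : ℕ}
    (ν νt : Measure (EuclideanSpace ℝ (Fin d)))
    (σ : Measure (EuclideanSpace ℝ (Fin d))) [IsFiniteMeasure σ]
    (τ : EuclideanSpace ℝ (Fin d) → Measure ℝ)
    (k : EuclideanSpace ℝ (Fin d) → ℝ → ℝ)
    (hσ : σ {x : EuclideanSpace ℝ (Fin d) | ¬ ‖x‖ = 1} = 0)
    (hLevy : IsLevyMeasure ν)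
    (hk0 : ∀ x, ∀ r : ℝ, 0 < r → 0 ≤ k x r)
    (hkcr : ∀ x, ContinuousOn (k x) (Ioi 0))
    (hkmono : ∀ x, AntitoneOn (k x) (Ioi 0))
    (hkcx : ∀ r : ℝ, 0 < r →
      ContinuousOn (fun x => k x r) {x : EuclideanSpace ℝ (Fin d) | ‖x‖ = 1})
    (hklim0 : ∀ x, ‖x‖ = 1 → Tendsto (fun r => r ^ 2 * k x r) (𝓝[>] 0) (𝓝 0))
    (hkliminfty : ∀ x, ‖x‖ = 1 → Tendsto (k x) atTop (𝓝 0))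
    (hpolar : ∀ g : EuclideanSpace ℝ (Fin d) → ℝ≥0∞, Measurable g →
      ∫⁻ u, g u ∂ν
        = ∫⁻ x, (∫⁻ r in Ioi (0 : ℝ), g (r • x) * ENNReal.ofReal (k x r / r)) ∂σ)
    (hτ : ∀ x : EuclideanSpace ℝ (Fin d),
      (∀ a c : ℝ, 0 < a → a ≤ c → τ x (Ioc a c) = ENNReal.ofReal (k x a - k x c))
        ∧ τ x (Iic 0) = 0)
    (hνt : ∀ g : EuclideanSpace ℝ (Fin d) → ℝ≥0∞, Measurable g →
      ∫⁻ u, g u ∂νt = ∫⁻ x, (∫⁻ r, g (r • x) ∂(τ x)) ∂σ) :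
    ∀ ξ : EuclideanSpace ℝ (Fin d),
      (∀ t ∈ Ici (0 : ℝ),
        HasDerivWithinAt (fun s => psiFn σ k s ξ)
          ((-(Complex.I) * ((Real.exp (-t) : ℝ) : ℂ)
              * ((⟪∫ x, k x 1 • x ∂σ, ξ⟫ : ℝ) : ℂ)
            + ∫ u, (Complex.exp (Complex.I * ((Real.exp (-t) * ⟪u, ξ⟫ : ℝ) : ℂ)) - 1
                - (if ‖u‖ ≤ 1 then Complex.I * ((Real.exp (-t) * ⟪u, ξ⟫ : ℝ) : ℂ) else 0)) ∂νt)
            * psiFn σ k t ξ)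
          (Ici 0) t)
      ∧ ContinuousOn (fun t =>
          (-(Complex.I) * ((Real.exp (-t) : ℝ) : ℂ)
              * ((⟪∫ x, k x 1 • x ∂σ, ξ⟫ : ℝ) : ℂ)
            + ∫ u, (Complex.exp (Complex.I * ((Real.exp (-t) * ⟪u, ξ⟫ : ℝ) : ℂ)) - 1
                - (if ‖u‖ ≤ 1 then Complex.I * ((Real.exp (-t) * ⟪u, ξ⟫ : ℝ) : ℂ) else 0)) ∂νt)
            * psiFn σ k t ξ) (Ici 0) := by
  intro ξ
  set S : Set (EuclideanSpace ℝ (Fin d)) := {x | ‖x‖ = 1} with hSdef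
  have hS : IsCompact S := by
    have : S = Metric.sphere 0 1 := by ext x; simp [hSdef]
    exact this ▸ isCompact_sphere 0 1
  obtain ⟨κ, hκ, hκS⟩ := exists_isSFiniteKernel_eq hS hS.measurableSet hkcx
    (fun x => (hτ x).1) (fun x => (hτ x).2)
  have hσS : ∀ᵐ x ∂σ, ‖x‖ = 1 := hσ
  have hIoi : ∀ x, ‖x‖ = 1 → ∀ r, 0 < r → κ x (Ioi r) = ENNReal.ofReal (k x r) :=
    fun x hx r hr => by
      rw [hκS x hx]
      exact measure_Ioi_eq_of_tendsto (fun c hc => (hτ x).1 r c hr hc) (hkliminfty x hx)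
  have hMae : ∀ᵐ p ∂(σ ⊗ₘ κ), ‖p.1‖ = 1 ∧ 0 < p.2 := by
    refine Measure.ae_compProd_of_ae_ae ?_ ?_
    · exact (measurableSet_eq_fun measurable_fst.norm measurable_const).inter
        (measurableSet_lt measurable_const measurable_snd)
    · filter_upwards [hσS] with x hx
      have h0 : ∀ᵐ r ∂κ x, 0 < r := by
        rw [hκS x hx, ae_iff]
        simpa [← Iic_def] using (hτ x).2
      exact h0.mono fun r hr => ⟨hx, hr⟩
  have hM0 : ∀ᵐ p ∂(σ ⊗ₘ κ), 0 < p.2 := hMae.mono fun p hp => hp.2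
  have hMa : ∀ᵐ p ∂(σ ⊗ₘ κ), |⟪p.1, ξ⟫| ≤ ‖ξ‖ := hMae.mono fun p hp => by
    simpa [hp.1] using abs_real_inner_le_norm p.1 ξ
  have hpmeas : Measurable fun p : EuclideanSpace ℝ (Fin d) × ℝ => p.2 • p.1 := by fun_prop
  have hmap : νt = (σ ⊗ₘ κ).map (fun p => p.2 • p.1) := by
    refine Measure.ext_of_lintegral _ fun g hg => ?_
    rw [hνt g hg, lintegral_map hg hpmeas,
      Measure.lintegral_compProd (f := fun p => g (p.2 • p.1)) (hg.comp hpmeas)]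
    exact lintegral_congr_ae (hσS.mono fun x hx => by simp only [hκS x hx])
  have hWσ : ∫⁻ x, ∫⁻ s, levyWeight s ∂(κ x) ∂σ < ⊤ := by
    refine lt_of_eq_of_lt ?_ hLevy.2
    rw [hpolar _ (by fun_prop)]
    refine lintegral_congr_ae (hσS.mono fun x hx => ?_)
    simp only
    rw [lintegral_levyWeight_eq (hIoi x hx)]
    refine setLIntegral_congr_fun measurableSet_Ioi fun r hr => ?_
    simp only [norm_smul, hx, mul_one, Real.norm_eq_abs, sq_abs]
  have hWM : ∫⁻ p, levyWeight p.2 ∂(σ ⊗ₘ κ) < ⊤ := by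
    rwa [Measure.lintegral_compProd (f := fun p => levyWeight p.2)
      (measurable_levyWeight.comp measurable_snd)]
  have hWx : ∀ᵐ x ∂σ, ∫⁻ s, levyWeight s ∂(κ x) < ⊤ :=
    ae_lt_top measurable_levyWeight.lintegral_kernel hWσ.ne
  have ha : Measurable fun p : EuclideanSpace ℝ (Fin d) × ℝ => ⟪p.1, ξ⟫ := by fun_prop
  have hderiv := fun t => hasDerivAt_integral_compExpPrim ha measurable_snd hMa hM0 hWM t
  have hcont := continuous_integral_compExpMin ha measurable_snd hMa hM0 hWM
  have hexponent : ∀ t : ℝ, (∫ x, (∫ r in Ioi (0 : ℝ),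
        (Complex.exp (Complex.I * ((r * ⟪x, ξ⟫ : ℝ) : ℂ)) - 1
          - (if r ≤ Real.exp (-t) then Complex.I * ((r * ⟪x, ξ⟫ : ℝ) : ℂ) else 0))
          * ((k x (Real.exp t * r) / r : ℝ) : ℂ)) ∂σ)
      = ∫ p, compExpPrim (Real.exp (-t) * ⟪p.1, ξ⟫) p.2 ∂(σ ⊗ₘ κ) := by
    intro t
    rw [Measure.integral_compProd (integrable_compExpPrim (ha.const_mul _) measurable_snd
      (hMa.mono fun p hp => abs_exp_neg_mul_le (Metric.mem_ball_self one_pos) hp) hWM)]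
    refine integral_congr_ae ?_
    filter_upwards [hσS, hWx] with x hx hW
    rw [← integral_compExp_mul_div_eq (hk0 x) (hIoi x hx) hW]
    have hsub := integral_comp_mul_left_Ioi
      (fun r => compExp (Real.exp (-t) * ⟪x, ξ⟫) r * ((k x r / r : ℝ) : ℂ)) 0 (Real.exp_pos t)
    rw [mul_zero, eq_inv_smul_iff₀ (Real.exp_pos t).ne', ← integral_smul] at hsub
    rw [← hsub]
    refine integral_congr_ae (ae_of_all _ fun r => ?_)
    have he : Real.exp t * r * (Real.exp (-t) * ⟪x, ξ⟫) = r * ⟪x, ξ⟫ := by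
      rw [Real.exp_neg]; field_simp
    have hle : Real.exp t * r ≤ 1 ↔ r ≤ Real.exp (-t) := by
      rw [Real.exp_neg, ← one_div, le_div_iff₀ (Real.exp_pos t), mul_comm]
    have hdiv : k x (Real.exp t * r) / r
        = Real.exp t * (k x (Real.exp t * r) / (Real.exp t * r)) := by
      field_simp
    simp only [compExp, he, hle, hdiv, Complex.real_smul]
    push_cast
    ring
  have hkint : Integrable (fun x => k x 1 • x) σ := by
    have h := ((hkcx 1 one_pos).smul continuousOn_id).integrableOn_compact (μ := σ) hS
    rwa [IntegrableOn, Measure.restrict_eq_self_of_ae_mem (s := S) hσS] at h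
  have hcoef : ∀ t : ℝ, -(Complex.I) * ((Real.exp (-t) : ℝ) : ℂ)
              * ((⟪∫ x, k x 1 • x ∂σ, ξ⟫ : ℝ) : ℂ)
            + ∫ u, (Complex.exp (Complex.I * ((Real.exp (-t) * ⟪u, ξ⟫ : ℝ) : ℂ)) - 1
                - (if ‖u‖ ≤ 1 then Complex.I * ((Real.exp (-t) * ⟪u, ξ⟫ : ℝ) : ℂ) else 0)) ∂νt
      = ∫ p, compExpMin (Real.exp (-t) * ⟪p.1, ξ⟫) p.2 ∂(σ ⊗ₘ κ) := by
    intro t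
    have hlarge : MeasurableSet {p : EuclideanSpace ℝ (Fin d) × ℝ | 1 < p.2} :=
      measurableSet_lt measurable_const measurable_snd
    have hZint : Integrable (fun p : EuclideanSpace ℝ (Fin d) × ℝ =>
        if 1 < p.2 then ⟪p.1, ξ⟫ else 0) (σ ⊗ₘ κ) := by
      refine Integrable.mono' ((integrable_min_one_sq measurable_snd hM0 hWM).const_mul ‖ξ‖)
        (Measurable.ite hlarge ha measurable_const).aestronglyMeasurable ?_
      filter_upwards [hMa] with p hp
      split_ifs with h
      · rw [min_eq_left (by nlinarith), mul_one]
        exact hp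
      · rw [norm_zero]
        positivity
    have hZ : ∫ p, (if 1 < p.2 then ⟪p.1, ξ⟫ else 0) ∂(σ ⊗ₘ κ)
        = ⟪∫ x, k x 1 • x ∂σ, ξ⟫ := by
      rw [Measure.integral_compProd hZint, real_inner_comm, ← integral_inner hkint]
      refine integral_congr_ae (hσS.mono fun x hx => ?_)
      have : (fun s : ℝ => if 1 < s then ⟪x, ξ⟫ else 0)
          = (Ioi 1).indicator (fun _ => ⟪x, ξ⟫) := rfl
      simp only [this]
      rw [integral_indicator measurableSet_Ioi, setIntegral_const, Measure.real,
        hIoi x hx 1 one_pos, ENNReal.toReal_ofReal (hk0 x 1 one_pos), real_inner_smul_right,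
        real_inner_comm, smul_eq_mul]
    have hνmeas : Measurable fun u : EuclideanSpace ℝ (Fin d) =>
        Complex.exp (Complex.I * ((Real.exp (-t) * ⟪u, ξ⟫ : ℝ) : ℂ)) - 1
          - (if ‖u‖ ≤ 1 then Complex.I * ((Real.exp (-t) * ⟪u, ξ⟫ : ℝ) : ℂ) else 0) := by
      refine Measurable.sub (by fun_prop) ?_
      exact Measurable.ite (measurableSet_le (by fun_prop) (by fun_prop)) (by fun_prop)
        (by fun_prop)
    rw [hmap, integral_map hpmeas.aemeasurable hνmeas.aestronglyMeasurable, ← hZ,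
      ← integral_complex_ofReal, ← integral_const_mul]
    have hsplit : (fun p : EuclideanSpace ℝ (Fin d) × ℝ =>
        Complex.exp (Complex.I * ((Real.exp (-t) * ⟪p.2 • p.1, ξ⟫ : ℝ) : ℂ)) - 1
          - (if ‖p.2 • p.1‖ ≤ 1 then
              Complex.I * ((Real.exp (-t) * ⟪p.2 • p.1, ξ⟫ : ℝ) : ℂ) else 0))
        =ᵐ[σ ⊗ₘ κ] fun p => compExpMin (Real.exp (-t) * ⟪p.1, ξ⟫) p.2
          - -(Complex.I) * ((Real.exp (-t) : ℝ) : ℂ)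
            * (((if 1 < p.2 then ⟪p.1, ξ⟫ else 0 : ℝ)) : ℂ) := by
      filter_upwards [hMae] with p hp
      have h1 : Real.exp (-t) * ⟪p.2 • p.1, ξ⟫ = p.2 * (Real.exp (-t) * ⟪p.1, ξ⟫) := by
        rw [real_inner_smul_left]; ring
      have h2 : ‖p.2 • p.1‖ = p.2 := by
        rw [norm_smul, hp.1, mul_one, Real.norm_of_nonneg hp.2.le]
      rw [h1, h2, compExpMin]
      rcases le_or_gt p.2 1 with h | h
      · rw [if_pos h, if_neg (not_lt.2 h), min_eq_left h]
        simp
      · rw [if_neg (not_le.2 h), if_pos h, min_eq_right h.le]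
        push_cast
        ring
    have hZint' : Integrable (fun p : EuclideanSpace ℝ (Fin d) × ℝ =>
        -(Complex.I) * ((Real.exp (-t) : ℝ) : ℂ)
          * (((if 1 < p.2 then ⟪p.1, ξ⟫ else 0 : ℝ)) : ℂ)) (σ ⊗ₘ κ) := hZint.ofReal.const_mul _
    rw [integral_congr_ae hsplit, integral_sub (hderiv t).1 hZint']
    ring
  have hpsi : ∀ t : ℝ, HasDerivAt (fun s => psiFn σ k s ξ)
      ((∫ p, compExpMin (Real.exp (-t) * ⟪p.1, ξ⟫) p.2 ∂(σ ⊗ₘ κ)) * psiFn σ k t ξ) t := by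
    intro t
    unfold psiFn
    simp only [hexponent]
    refine ((hderiv t).2.const_sub _).cexp.congr_deriv ?_
    ring
  simp only [hcoef]
  refine ⟨fun t _ => (hpsi t).hasDerivWithinAt, Continuous.continuousOn (hcont.mul ?_)⟩
  exact continuous_iff_continuousAt.2 fun t => (hpsi t).continuousAt
end
end
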